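/- arXiv:1003.0442 — 11 statements merged into one kernel-verified Lean document; each statement's English description precedes it below -/
import Mathlib

section
/- Let r2 : ℝ → ℝ³ be a map satisfying ‖r2 s − r2 s'‖ ≤ v1·|s − s'| for all s, s' ∈ ℝ, where 0 ≤ v1 < 1. Then for every r1 ∈ ℝ³ and every t ∈ ℝ there exists a unique real number τ such that τ = t − ‖r1 − r2 τ‖; moreover this τ satisfies τ ≤ t. -/
/-- If the trajectory is Lipschitz with constant less than `1`, the retarded-time map
`τ ↦ t - ‖x - r τ‖` is a contraction with the same constant. -/
theorem contractingWith_sub_norm_sub {E : Type*} [SeminormedAddCommGroup E] {K : NNReal}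
    {r : ℝ → E} (hK : K < 1) (hr : LipschitzWith K r) (x : E) (t : ℝ) :
    ContractingWith K fun τ => t - ‖x - r τ‖ := by
  refine ⟨hK, LipschitzWith.of_dist_le_mul fun a b => ?_⟩
  calc dist (t - ‖x - r a‖) (t - ‖x - r b‖) = dist ‖x - r a‖ ‖x - r b‖ := dist_sub_left _ _ _
    _ ≤ dist (x - r a) (x - r b) :=
      (dist_norm_norm_le _ _).trans_eq (dist_eq_norm _ _).symm
    _ = dist (r a) (r b) := dist_sub_left _ _ _
    _ ≤ K * dist a b := hr.dist_le_mul a b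

/-- existence, uniqueness and `τ ≤ t` for the retarded time. -/
theorem retarded_time_exists_unique
    (r2 : ℝ → EuclideanSpace ℝ (Fin 3)) (v1 : ℝ)
    (hv0 : 0 ≤ v1) (hv1 : v1 < 1)
    (hlip : ∀ s s' : ℝ, ‖r2 s - r2 s'‖ ≤ v1 * |s - s'|)
    (r1 : EuclideanSpace ℝ (Fin 3)) (t : ℝ) :
    ∃ τ : ℝ, (τ = t - ‖r1 - r2 τ‖ ∧ τ ≤ t) ∧
      ∀ τ' : ℝ, τ' = t - ‖r1 - r2 τ'‖ → τ' = τ := by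
  have hr : LipschitzWith ⟨v1, hv0⟩ r2 := LipschitzWith.of_dist_le_mul fun s s' => by
    rw [dist_eq_norm, Real.dist_eq]
    exact hlip s s'
  have hf := contractingWith_sub_norm_sub (K := ⟨v1, hv0⟩) hv1 hr r1 t
  have hfix := hf.fixedPoint_isFixedPt.symm
  exact ⟨_, ⟨hfix, hfix.trans_le (sub_le_self _ (norm_nonneg _))⟩,
    fun _ h => hf.fixedPoint_unique h.symm⟩
end

section
/- Let r2 : ℝ → ℝ³ satisfy ‖r2 s − r2 s'‖ ≤ v1·|s − s'| for all s, s' ∈ ℝ with 0 ≤ v1 < 1, and for each (r1, t) ∈ ℝ³ × ℝ let τ(r1, t) be the unique real number with τ(r1,t) = t − ‖r1 − r2 (τ(r1,t))‖. Then for all (r1, t), (r̃1, t̃) ∈ ℝ³ × ℝ one has |τ(r1, t) − τ(r̃1, t̃)| ≤ (1 − v1)⁻¹·(|t − t̃| + ‖r1 − r̃1‖). In particular the retarded time function τ is Lipschitz, hence continuous, on ℝ³ × ℝ. -/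
/-- Lipschitz estimate and continuity of the retarded time field. -/
theorem retarded_time_lipschitz_continuous
    (r2 : ℝ → EuclideanSpace ℝ (Fin 3)) (v1 : ℝ)
    (hv0 : 0 ≤ v1) (hv1 : v1 < 1)
    (hlip : ∀ s s' : ℝ, ‖r2 s - r2 s'‖ ≤ v1 * |s - s'|)
    (τ : EuclideanSpace ℝ (Fin 3) × ℝ → ℝ)
    (hτ : ∀ p : EuclideanSpace ℝ (Fin 3) × ℝ, τ p = p.2 - ‖p.1 - r2 (τ p)‖) :
    (∀ p q : EuclideanSpace ℝ (Fin 3) × ℝ,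
        |τ p - τ q| ≤ (1 - v1)⁻¹ * (|p.2 - q.2| + ‖p.1 - q.1‖)) ∧
      Continuous τ := by
  have estimate : ∀ p q : EuclideanSpace ℝ (Fin 3) × ℝ,
      |τ p - τ q| ≤ (1 - v1)⁻¹ * (|p.2 - q.2| + ‖p.1 - q.1‖) := by
    intro p q
    have hnorm : |‖q.1 - r2 (τ q)‖ - ‖p.1 - r2 (τ p)‖| ≤
        ‖p.1 - q.1‖ + v1 * |τ p - τ q| :=
      calc |‖q.1 - r2 (τ q)‖ - ‖p.1 - r2 (τ p)‖|
          ≤ ‖(q.1 - r2 (τ q)) - (p.1 - r2 (τ p))‖ := abs_norm_sub_norm_le _ _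
        _ = ‖(r2 (τ p) - r2 (τ q)) - (p.1 - q.1)‖ := by congr 1; abel
        _ ≤ ‖r2 (τ p) - r2 (τ q)‖ + ‖p.1 - q.1‖ := norm_sub_le _ _
        _ ≤ ‖p.1 - q.1‖ + v1 * |τ p - τ q| := by linarith [hlip (τ p) (τ q)]
    have hsplit : τ p - τ q =
        (p.2 - q.2) + (‖q.1 - r2 (τ q)‖ - ‖p.1 - r2 (τ p)‖) := by
      linarith [hτ p, hτ q]
    have habs := abs_add_le (p.2 - q.2) (‖q.1 - r2 (τ q)‖ - ‖p.1 - r2 (τ p)‖)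
    rw [← hsplit] at habs
    rw [le_inv_mul_iff₀ (sub_pos.2 hv1)]
    linarith
  refine ⟨estimate, continuous_iff_continuousAt.2 fun p => ?_⟩
  refine tendsto_iff_dist_tendsto_zero.2 (squeeze_zero (fun _ => dist_nonneg)
    (fun q => (Real.dist_eq _ _).trans_le (estimate q p)) ?_)
  have hcont : Continuous fun q : EuclideanSpace ℝ (Fin 3) × ℝ =>
      (1 - v1)⁻¹ * (|q.2 - p.2| + ‖q.1 - p.1‖) := by fun_prop
  simpa using hcont.tendsto p
end

section
/- Let r2 : ℝ → ℝ³ be continuously differentiable with ‖r2' s‖ ≤ v1 for all s ∈ ℝ, where 0 ≤ v1 < 1. Then at every point (r1, t) of G the retarded time field τ is differentiable, with time derivative Dτ = z and spatial partial derivatives Dᵢτ = −z·eᵢ for i = 1,2,3; equivalently, the total differential of τ at (r1,t) sends an increment (dr, dt) ∈ ℝ³ × ℝ to z·(dt − ⟨e, dr⟩). -/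
open scoped RealInnerProductSpace

/-- A function implicitly defined by a scalar equation `F (x, g x) = 0` is differentiable at `a`
as soon as `F` is differentiable at `(a, g a)` with nonzero partial derivative in the last variable
and `g` satisfies a Lipschitz bound at `a`. -/
theorem HasFDerivAt.of_implicit_of_isBigO {X : Type*} [NormedAddCommGroup X] [NormedSpace ℝ X]
    {F : X × ℝ → ℝ} {F' : X × ℝ →L[ℝ] ℝ} {g : X → ℝ} {L : X →L[ℝ] ℝ} {a : X} {c : ℝ}
    (hF : HasFDerivAt F F' (a, g a)) (hzero : ∀ x, F (x, g x) = 0)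
    (hg : (fun x => g x - g a) =O[nhds a] fun x => x - a) (hc : c ≠ 0)
    (hF' : ∀ dx ds, F' (dx, ds) = c * (ds - L dx)) : HasFDerivAt g L a := by
  have hcont : Filter.Tendsto (fun x => (x, g x)) (nhds a) (nhds (a, g a)) := by
    refine Filter.tendsto_id.prodMk_nhds (tendsto_sub_nhds_zero_iff.mp (hg.trans_tendsto ?_))
    exact tendsto_sub_nhds_zero_iff.mpr Filter.tendsto_id
  have hbig : (fun x => (x, g x) - (a, g a)) =O[nhds a] fun x => x - a :=
    (Asymptotics.isBigO_refl _ _).prod_left hg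
  have hlittle := ((hF.isLittleO.comp_tendsto hcont).trans_isBigO hbig).const_mul_left (-c⁻¹)
  refine HasFDerivAt.of_isLittleO (hlittle.congr_left fun x => ?_)
  simp only [Function.comp_apply, hzero, Prod.mk_sub_mk, hF']
  field_simp
  ring

/-- If the source moves with speed at most `k < 1`, its retarded time is Lipschitz. -/
theorem retarded_time_sub_le {E : Type*} [NormedAddCommGroup E] {r : ℝ → E} {k : ℝ} (hk : k < 1)
    (hr : ∀ s s', ‖r s - r s'‖ ≤ k * |s - s'|) {τ : E × ℝ → ℝ}
    (hτ : ∀ p, τ p = p.2 - ‖p.1 - r (τ p)‖) (p q : E × ℝ) :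
    |τ p - τ q| ≤ 2 / (1 - k) * ‖p - q‖ := by
  have hnorm : |‖p.1 - r (τ p)‖ - ‖q.1 - r (τ q)‖| ≤ ‖p.1 - q.1‖ + ‖r (τ p) - r (τ q)‖ := by
    refine (abs_norm_sub_norm_le _ _).trans ?_
    rw [sub_sub_sub_comm]
    exact norm_sub_le _ _
  have htime : |τ p - τ q| ≤ |p.2 - q.2| + |‖p.1 - r (τ p)‖ - ‖q.1 - r (τ q)‖| := by
    have h : τ p - τ q = (p.2 - q.2) - (‖p.1 - r (τ p)‖ - ‖q.1 - r (τ q)‖) := by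
      linear_combination hτ p - hτ q
    exact h ▸ abs_sub _ _
  have hfst : ‖p.1 - q.1‖ ≤ ‖p - q‖ := norm_fst_le (p - q)
  have hsnd : |p.2 - q.2| ≤ ‖p - q‖ := norm_snd_le (p - q)
  have hlip := hr (τ p) (τ q)
  rw [div_mul_eq_mul_div, le_div_iff₀ (sub_pos.mpr hk)]
  linarith

/-- differentiability of the retarded time field `τ` on `G`,
with `Dτ = z`, `Dᵢτ = −z·eᵢ`; i.e. the total differential sends `(dr, dt)`
to `z·(dt − ⟨e, dr⟩)`. -/
theorem retarded_time_field_differential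
    (r2 : ℝ → EuclideanSpace ℝ (Fin 3)) (v1 : ℝ)
    (hv0 : 0 ≤ v1) (hv1 : v1 < 1)
    (hC1 : ContDiff ℝ 1 r2) (hbd : ∀ s : ℝ, ‖deriv r2 s‖ ≤ v1)
    (τ : EuclideanSpace ℝ (Fin 3) × ℝ → ℝ)
    (hτ : ∀ p : EuclideanSpace ℝ (Fin 3) × ℝ, τ p = p.2 - ‖p.1 - r2 (τ p)‖)
    (T : EuclideanSpace ℝ (Fin 3) × ℝ → ℝ)
    (hT : ∀ p, T p = p.2 - τ p)
    (e : EuclideanSpace ℝ (Fin 3) × ℝ → EuclideanSpace ℝ (Fin 3))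
    (he : ∀ p, e p = (T p)⁻¹ • (p.1 - r2 (τ p)))
    (v : EuclideanSpace ℝ (Fin 3) × ℝ → EuclideanSpace ℝ (Fin 3))
    (hv : ∀ p, v p = deriv r2 (τ p))
    (z : EuclideanSpace ℝ (Fin 3) × ℝ → ℝ)
    (hz : ∀ p, z p = (1 - ⟪e p, v p⟫)⁻¹)
    (r1 : EuclideanSpace ℝ (Fin 3)) (t : ℝ)
    (hG : 0 < T (r1, t)) :
    ∃ L : EuclideanSpace ℝ (Fin 3) × ℝ →L[ℝ] ℝ,
      HasFDerivAt τ L (r1, t) ∧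
        ∀ (dr : EuclideanSpace ℝ (Fin 3)) (dt : ℝ),
          L (dr, dt) = z (r1, t) * (dt - ⟪e (r1, t), dr⟫) := by
  have hdiff : Differentiable ℝ r2 := hC1.differentiable one_ne_zero
  have hlip (s s' : ℝ) : ‖r2 s - r2 s'‖ ≤ v1 * |s - s'| :=
    convex_univ.norm_image_sub_le_of_norm_deriv_le (fun x _ => hdiff x) (fun x _ => hbd x)
      (Set.mem_univ s') (Set.mem_univ s)
  have hTnorm : T (r1, t) = ‖r1 - r2 (τ (r1, t))‖ := by
    have h := hτ (r1, t)
    rw [hT]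
    linarith
  have he_norm : ‖e (r1, t)‖ = 1 := by
    rw [he, norm_smul, norm_inv, Real.norm_of_nonneg hG.le, ← hTnorm, inv_mul_cancel₀ hG.ne']
  have hr12 : r1 - r2 (τ (r1, t)) = T (r1, t) • e (r1, t) := by
    rw [he, smul_inv_smul₀ hG.ne']
  have hpos : 0 < 1 - ⟪e (r1, t), v (r1, t)⟫ := by
    have h := real_inner_le_norm (e (r1, t)) (v (r1, t))
    have hv_norm : ‖v (r1, t)‖ ≤ v1 := hv (r1, t) ▸ hbd _
    rw [he_norm, one_mul] at h
    linarith
  let E3 := EuclideanSpace ℝ (Fin 3)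
  have hr2 : HasFDerivAt (fun q : (E3 × ℝ) × ℝ => r2 q.2)
      ((ContinuousLinearMap.toSpanSingleton ℝ (v (r1, t))).comp
        (ContinuousLinearMap.snd ℝ (E3 × ℝ) ℝ)) ((r1, t), τ (r1, t)) := by
    rw [hv]
    exact (hdiff (τ (r1, t))).hasDerivAt.hasFDerivAt.comp ((r1, t), τ (r1, t)) hasFDerivAt_snd
  have hfst : HasFDerivAt (fun q : (E3 × ℝ) × ℝ => q.1.1) _ ((r1, t), τ (r1, t)) :=
    (hasFDerivAt_fst (𝕜 := ℝ) (p := (r1, t))).comp ((r1, t), τ (r1, t)) hasFDerivAt_fst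
  have hsnd : HasFDerivAt (fun q : (E3 × ℝ) × ℝ => q.1.2) _ ((r1, t), τ (r1, t)) :=
    (hasFDerivAt_snd (𝕜 := ℝ) (p := (r1, t))).comp ((r1, t), τ (r1, t)) hasFDerivAt_fst
  have hF := (hfst.sub hr2).norm_sq.sub ((hsnd.sub hasFDerivAt_snd).pow 2)
  refine ⟨z (r1, t) • (ContinuousLinearMap.snd ℝ E3 ℝ -
    (innerSL ℝ (e (r1, t))).comp (ContinuousLinearMap.fst ℝ E3 ℝ)),
    HasFDerivAt.of_implicit_of_isBigO (c := 2 * T (r1, t) * (1 - ⟪e (r1, t), v (r1, t)⟫)) hF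
      (fun p => ?_) ?_ (by positivity) ?_, fun dr dt => by simp⟩
  · have h : p.2 - τ p = ‖p.1 - r2 (τ p)‖ := by linarith [hτ p]
    simp [h]
  · exact Asymptotics.IsBigO.of_bound _
      (Filter.Eventually.of_forall fun p => retarded_time_sub_le hv1 hlip hτ p (r1, t))
  · rintro ⟨dr, dt⟩ ds
    simp [hr12, hz]
    field_simp
    linear_combination (dt - ds) * hT (r1, t)
end

section
/- Let r2 : ℝ → ℝ³ be continuously differentiable with ‖r2' s‖ ≤ v1 for all s ∈ ℝ, where 0 ≤ v1 < 1. Then at every point (r1, t) of G the delay field T is differentiable, with time derivative DT = 1 − z and spatial partial derivatives DᵢT = z·eᵢ for i = 1,2,3. -/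
open scoped RealInnerProductSpace

section DelayField

/-- A solution of the retarded-time equation for a trajectory of speed less than one is Lipschitz. -/
theorem lipschitz_retarded_time {E : Type*} [NormedAddCommGroup E] {r2 : ℝ → E} {v1 : ℝ}
    (hv1 : v1 < 1)
    (hlip : ∀ s s' : ℝ, ‖r2 s - r2 s'‖ ≤ v1 * |s - s'|)
    {τ : E × ℝ → ℝ} (hτ : ∀ p : E × ℝ, τ p = p.2 - ‖p.1 - r2 (τ p)‖) (p q : E × ℝ) :
    |τ p - τ q| ≤ 2 / (1 - v1) * ‖p - q‖ := by
  have h1 : |τ p - τ q| ≤ |p.2 - q.2| + ‖(p.1 - r2 (τ p)) - (q.1 - r2 (τ q))‖ := by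
    have h := abs_norm_sub_norm_le (p.1 - r2 (τ p)) (q.1 - r2 (τ q))
    have h' : τ p - τ q =
        (p.2 - q.2) - (‖p.1 - r2 (τ p)‖ - ‖q.1 - r2 (τ q)‖) := by
      linarith [hτ p, hτ q]
    calc |τ p - τ q| = |(p.2 - q.2) - (‖p.1 - r2 (τ p)‖ - ‖q.1 - r2 (τ q)‖)| := by rw [← h']
      _ ≤ _ := (abs_sub _ _).trans (by gcongr)
  have h2 : ‖(p.1 - r2 (τ p)) - (q.1 - r2 (τ q))‖ ≤ ‖p.1 - q.1‖ + v1 * |τ p - τ q| := by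
    rw [sub_sub_sub_comm]
    exact (norm_sub_le _ _).trans (by gcongr; exact hlip _ _)
  have h3 : ‖p.1 - q.1‖ ≤ ‖p - q‖ := norm_fst_le (p - q)
  have h4 : |p.2 - q.2| ≤ ‖p - q‖ := norm_snd_le (p - q)
  rw [div_mul_eq_mul_div, le_div_iff₀ (by linarith)]
  linarith

variable {E : Type*} [NormedAddCommGroup E] [InnerProductSpace ℝ E]

/-- The derivative of `(r, s) ↦ (r, s + ‖r - r2 s‖)` as a continuous linear equivalence, in terms
of the unit vector `e` and the velocity `w`. -/
noncomputable def lightConeEquiv (e w : E) (h : 1 - ⟪e, w⟫ ≠ 0) : (E × ℝ) ≃L[ℝ] (E × ℝ) :=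
  ContinuousLinearEquiv.equivOfInverse
    ((ContinuousLinearMap.fst ℝ E ℝ).prod
      ((1 - ⟪e, w⟫) • ContinuousLinearMap.snd ℝ E ℝ +
        (innerSL ℝ e).comp (ContinuousLinearMap.fst ℝ E ℝ)))
    ((ContinuousLinearMap.fst ℝ E ℝ).prod
      ((1 - ⟪e, w⟫)⁻¹ • (ContinuousLinearMap.snd ℝ E ℝ -
        (innerSL ℝ e).comp (ContinuousLinearMap.fst ℝ E ℝ))))
    (fun x => by ext <;> simp [h])
    (fun x => by ext <;> simp [h])

theorem hasFDerivAt_norm_of_ne {x : E} (hx : x ≠ 0) :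
    HasFDerivAt (fun y : E => ‖y‖) (innerSL ℝ (‖x‖⁻¹ • x)) x := by
  have h := (hasStrictFDerivAt_norm_sq x).hasFDerivAt.sqrt (by simpa using hx)
  simp only [Real.sqrt_sq (norm_nonneg _)] at h
  refine h.congr_fderiv ?_
  ext y
  simp
  field_simp

/-- The derivative of the retarded time away from the trajectory. -/
theorem hasFDerivAt_retarded_time {r2 : ℝ → E} {τ : E × ℝ → ℝ} {p : E × ℝ} {e w : E}
    (hτ : ∀ p : E × ℝ, τ p = p.2 - ‖p.1 - r2 (τ p)‖) (hcont : ContinuousAt τ p)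
    (hne : p.1 - r2 (τ p) ≠ 0) (he : e = ‖p.1 - r2 (τ p)‖⁻¹ • (p.1 - r2 (τ p)))
    (hw : HasDerivAt r2 w (τ p)) (h : 1 - ⟪e, w⟫ ≠ 0) :
    HasFDerivAt τ ((1 - ⟪e, w⟫)⁻¹ • (ContinuousLinearMap.snd ℝ E ℝ -
        (innerSL ℝ e).comp (ContinuousLinearMap.fst ℝ E ℝ))) p := by
  have hΦ : HasFDerivAt (fun q : E × ℝ => (q.1, q.2 + ‖q.1 - r2 q.2‖))
      (lightConeEquiv e w h : (E × ℝ) →L[ℝ] (E × ℝ)) (p.1, τ p) := by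
    have h2 : HasFDerivAt (fun q : E × ℝ => r2 q.2) _ (p.1, τ p) :=
      HasFDerivAt.comp (p.1, τ p) (g := r2) hw.hasFDerivAt hasFDerivAt_snd
    have h3 : HasFDerivAt (fun q : E × ℝ => ‖q.1 - r2 q.2‖) _ (p.1, τ p) :=
      HasFDerivAt.comp (p.1, τ p) (g := fun y : E => ‖y‖) (f := fun q : E × ℝ => q.1 - r2 q.2)
        (hasFDerivAt_norm_of_ne hne) (hasFDerivAt_fst.sub h2)
    refine (hasFDerivAt_fst.prodMk (hasFDerivAt_snd.add h3)).congr_fderiv ?_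
    rw [← he]
    refine ContinuousLinearMap.ext fun x => Prod.ext rfl ?_
    simp [lightConeEquiv]
    ring
  have hg : HasFDerivAt (fun q : E × ℝ => (q.1, τ q)) _ p :=
    HasFDerivAt.of_local_left_inverse (continuousAt_fst.prodMk hcont) hΦ
      (.of_forall fun q => Prod.ext rfl (by simp only; linarith [hτ q]))
  exact hg.snd

end DelayField

/-- differentiability of the delay field `T` on `G`,
with `DT = 1 − z` and `DᵢT = z·eᵢ`. -/
theorem delay_field_differential
    (r2 : ℝ → EuclideanSpace ℝ (Fin 3)) (v1 : ℝ)
    (hv0 : 0 ≤ v1) (hv1 : v1 < 1)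
    (hC1 : ContDiff ℝ 1 r2) (hbd : ∀ s : ℝ, ‖deriv r2 s‖ ≤ v1)
    (τ : EuclideanSpace ℝ (Fin 3) × ℝ → ℝ)
    (hτ : ∀ p : EuclideanSpace ℝ (Fin 3) × ℝ, τ p = p.2 - ‖p.1 - r2 (τ p)‖)
    (T : EuclideanSpace ℝ (Fin 3) × ℝ → ℝ)
    (hT : ∀ p, T p = p.2 - τ p)
    (e : EuclideanSpace ℝ (Fin 3) × ℝ → EuclideanSpace ℝ (Fin 3))
    (he : ∀ p, e p = (T p)⁻¹ • (p.1 - r2 (τ p)))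
    (v : EuclideanSpace ℝ (Fin 3) × ℝ → EuclideanSpace ℝ (Fin 3))
    (hv : ∀ p, v p = deriv r2 (τ p))
    (z : EuclideanSpace ℝ (Fin 3) × ℝ → ℝ)
    (hz : ∀ p, z p = (1 - ⟪e p, v p⟫)⁻¹)
    (r1 : EuclideanSpace ℝ (Fin 3)) (t : ℝ)
    (hG : 0 < T (r1, t)) :
    ∃ L : EuclideanSpace ℝ (Fin 3) × ℝ →L[ℝ] ℝ,
      HasFDerivAt T L (r1, t) ∧
        ∀ (dr : EuclideanSpace ℝ (Fin 3)) (dt : ℝ),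
          L (dr, dt) =
            dt * (1 - z (r1, t)) +
              ∑ i : Fin 3, dr i * (z (r1, t) * e (r1, t) i) := by
  have hlip (s s' : ℝ) : ‖r2 s - r2 s'‖ ≤ v1 * |s - s'| :=
    Convex.norm_image_sub_le_of_norm_deriv_le
      (fun x _ => (hC1.differentiable one_ne_zero).differentiableAt) (fun x _ => hbd x)
      convex_univ (Set.mem_univ s') (Set.mem_univ s)
  have hcont : ContinuousAt τ (r1, t) :=
    (LipschitzWith.of_dist_le' fun p q => by
      simpa only [dist_eq_norm, Real.norm_eq_abs] using
        lipschitz_retarded_time hv1 hlip hτ p q).continuous.continuousAt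
  have hTn : T (r1, t) = ‖r1 - r2 (τ (r1, t))‖ := by linarith [hT (r1, t), hτ (r1, t)]
  have hpos : 0 < ‖r1 - r2 (τ (r1, t))‖ := hTn ▸ hG
  have hen : ‖e (r1, t)‖ = 1 := by
    rw [he, hTn, norm_smul, norm_inv, norm_norm, inv_mul_cancel₀ hpos.ne']
  have hlt : ⟪e (r1, t), v (r1, t)⟫ < 1 := by
    have h := real_inner_le_norm (e (r1, t)) (v (r1, t))
    rw [hen, one_mul, hv] at h
    rw [hv]
    exact (h.trans (hbd _)).trans_lt hv1
  have hw : HasDerivAt r2 (v (r1, t)) (τ (r1, t)) := by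
    rw [hv]
    exact (hC1.differentiable one_ne_zero).differentiableAt.hasDerivAt
  have hder := hasFDerivAt_retarded_time hτ hcont (norm_pos_iff.mp hpos)
    (by rw [he, hTn]) hw (sub_pos.mpr hlt).ne'
  rw [← hz] at hder
  refine ⟨_, (hasFDerivAt_snd.sub hder).congr_of_eventuallyEq (.of_forall hT), fun dr dt => ?_⟩
  have hinner : ⟪e (r1, t), dr⟫ = ∑ i : Fin 3, dr i * e (r1, t) i := by
    simp [PiLp.inner_apply]
  have hsum : ∑ i : Fin 3, dr i * (z (r1, t) * e (r1, t) i) = z (r1, t) * ⟪e (r1, t), dr⟫ := by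
    rw [hinner, Finset.mul_sum]
    exact Finset.sum_congr rfl fun i _ => by ring
  rw [hsum]
  simp
  ring
end

section
/- Let r2 : ℝ → ℝ³ be continuously differentiable with ‖r2' s‖ ≤ v1 for all s ∈ ℝ, where 0 ≤ v1 < 1. Then at every point (r1, t) of G the field u = 1/T is differentiable, with time derivative Du = z·u² − u² and spatial partial derivatives Dᵢu = −z·u²·eᵢ for i = 1,2,3. -/
open scoped RealInnerProductSpace

open Asymptotics Filter Topology

/-- A function defined implicitly by `F (y, φ y) = 0` which is Lipschitz at `x` is differentiable
at `x` as soon as `F` is differentiable at `(x, φ x)` with nonzero partial derivative. -/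
theorem HasFDerivAt.of_implicit_of_isBigO_s9 {E : Type*} [NormedAddCommGroup E] [NormedSpace ℝ E]
    {F : E × ℝ → ℝ} {F' : E × ℝ →L[ℝ] ℝ} {φ : E → ℝ} {x : E}
    (hF : HasFDerivAt F F' (x, φ x)) (hzero : ∀ y, F (y, φ y) = 0)
    (hφ : (fun y => φ y - φ x) =O[𝓝 x] fun y => y - x) (hF' : F' (0, 1) ≠ 0) :
    HasFDerivAt φ (-(F' (0, 1))⁻¹ • F'.comp (ContinuousLinearMap.inl ℝ E ℝ)) x := by
  have hsub : Tendsto (fun y => y - x) (𝓝 x) (𝓝 0) := by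
    have : ContinuousAt (fun y => y - x) x := by fun_prop
    simpa [ContinuousAt] using this
  have hcont : Tendsto φ (𝓝 x) (𝓝 (φ x)) :=
    tendsto_sub_nhds_zero_iff.mp (hφ.trans_tendsto hsub)
  have hgraph : Tendsto (fun y => (y, φ y)) (𝓝 x) (𝓝 (x, φ x)) :=
    tendsto_id.prodMk_nhds hcont
  have hlin := (hF.isLittleO.comp_tendsto hgraph).trans_isBigO
    ((isBigO_refl (fun y => y - x) (𝓝 x)).prod_left hφ)
  refine .of_isLittleO ((hlin.const_mul_left (-(F' (0, 1))⁻¹)).congr_left fun y => ?_)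
  have hsplit : F' (y - x, φ y - φ x) = F' (y - x, 0) + (φ y - φ x) * F' (0, 1) := by
    rw [← smul_eq_mul, ← map_smul, ← map_add]
    simp
  simp only [Function.comp_apply, hzero, Prod.mk_sub_mk, hsplit, smul_apply,
    ContinuousLinearMap.comp_apply, ContinuousLinearMap.inl_apply, smul_eq_mul]
  field_simp
  ring

/-- The retarded time of a trajectory of speed at most `c < 1` is Lipschitz. -/
theorem abs_retardedTime_sub_le {E : Type*} [NormedAddCommGroup E] {r : ℝ → E} {c : ℝ}
    (hc : c < 1) (hr : ∀ s s', ‖r s - r s'‖ ≤ c * |s - s'|) {τ : E × ℝ → ℝ}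
    (hτ : ∀ p, τ p = p.2 - ‖p.1 - r (τ p)‖) (p q : E × ℝ) :
    |τ p - τ q| ≤ 2 / (1 - c) * ‖p - q‖ := by
  have h1 : |p.2 - q.2| ≤ ‖p - q‖ := norm_snd_le (p - q)
  have h2 : ‖p.1 - q.1‖ ≤ ‖p - q‖ := norm_fst_le (p - q)
  have h3 : |‖p.1 - r (τ p)‖ - ‖q.1 - r (τ q)‖| ≤ ‖p.1 - q.1‖ + ‖r (τ p) - r (τ q)‖ :=
    (abs_norm_sub_norm_le _ _).trans <| by
      rw [sub_sub_sub_comm]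
      exact norm_sub_le _ _
  have h4 : |τ p - τ q| ≤ |p.2 - q.2| + |‖p.1 - r (τ p)‖ - ‖q.1 - r (τ q)‖| := by
    conv_lhs => rw [hτ p, hτ q, sub_sub_sub_comm]
    exact abs_sub _ _
  have h5 := hr (τ p) (τ q)
  rw [div_mul_eq_mul_div, le_div_iff₀ (by linarith)]
  linarith

/-- The defining function of the light cone, whose zero set contains the graph of the retarded
time, is differentiable. -/
theorem hasFDerivAt_lightCone {E : Type*} [NormedAddCommGroup E] [InnerProductSpace ℝ E]
    {r : ℝ → E} {w : E} (q : (E × ℝ) × ℝ) (hr : HasDerivAt r w q.2) :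
    ∃ F' : (E × ℝ) × ℝ →L[ℝ] ℝ,
      HasFDerivAt (fun q : (E × ℝ) × ℝ => ‖q.1.1 - r q.2‖ ^ 2 - (q.1.2 - q.2) ^ 2) F' q ∧
        ∀ dx dt ds, F' ((dx, dt), ds) =
          2 * ⟪q.1.1 - r q.2, dx - ds • w⟫ - 2 * (q.1.2 - q.2) * (dt - ds) := by
  have hfst := hasFDerivAt_fst (𝕜 := ℝ) (p := q)
  have hsnd := hasFDerivAt_snd (𝕜 := ℝ) (p := q)
  have hpos := (hfst.fst.sub (hr.hasFDerivAt.comp q hsnd)).norm_sq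
  have htime := (hfst.snd.sub hsnd).pow 2
  refine ⟨_, hpos.sub htime, fun dx dt ds => ?_⟩
  simp [inner_sub_right, inner_sub_left, inner_smul_right]
  ring

/-- differentiability of the field `u = 1/T` on `G`,
with `Du = z·u² − u²` and `Dᵢu = −z·u²·eᵢ`. -/
theorem u_field_differential
    (r2 : ℝ → EuclideanSpace ℝ (Fin 3)) (v1 : ℝ)
    (hv0 : 0 ≤ v1) (hv1 : v1 < 1)
    (hC1 : ContDiff ℝ 1 r2) (hbd : ∀ s : ℝ, ‖deriv r2 s‖ ≤ v1)
    (τ : EuclideanSpace ℝ (Fin 3) × ℝ → ℝ)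
    (hτ : ∀ p : EuclideanSpace ℝ (Fin 3) × ℝ, τ p = p.2 - ‖p.1 - r2 (τ p)‖)
    (T : EuclideanSpace ℝ (Fin 3) × ℝ → ℝ)
    (hT : ∀ p, T p = p.2 - τ p)
    (u : EuclideanSpace ℝ (Fin 3) × ℝ → ℝ)
    (hu : ∀ p, u p = (T p)⁻¹)
    (e : EuclideanSpace ℝ (Fin 3) × ℝ → EuclideanSpace ℝ (Fin 3))
    (he : ∀ p, e p = (T p)⁻¹ • (p.1 - r2 (τ p)))
    (v : EuclideanSpace ℝ (Fin 3) × ℝ → EuclideanSpace ℝ (Fin 3))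
    (hv : ∀ p, v p = deriv r2 (τ p))
    (z : EuclideanSpace ℝ (Fin 3) × ℝ → ℝ)
    (hz : ∀ p, z p = (1 - ⟪e p, v p⟫)⁻¹)
    (r1 : EuclideanSpace ℝ (Fin 3)) (t : ℝ)
    (hG : 0 < T (r1, t)) :
    ∃ L : EuclideanSpace ℝ (Fin 3) × ℝ →L[ℝ] ℝ,
      HasFDerivAt u L (r1, t) ∧
        ∀ (dr : EuclideanSpace ℝ (Fin 3)) (dt : ℝ),
          L (dr, dt) =
            dt * (z (r1, t) * u (r1, t) ^ 2 - u (r1, t) ^ 2) +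
              ∑ i : Fin 3, dr i * (-(z (r1, t) * u (r1, t) ^ 2 * e (r1, t) i)) := by
  have hlip (s s' : ℝ) : ‖r2 s - r2 s'‖ ≤ v1 * |s - s'| :=
    convex_univ.norm_image_sub_le_of_norm_deriv_le
      (fun x _ => hC1.differentiable one_ne_zero x) (fun x _ => hbd x) trivial trivial
  have hTnorm (p) : T p = ‖p.1 - r2 (τ p)‖ := by
    rw [hT]
    linarith [hτ p]
  set p : EuclideanSpace ℝ (Fin 3) × ℝ := (r1, t)
  have hτO : (fun q => τ q - τ p) =O[𝓝 p] fun q => q - p :=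
    .of_bound (2 / (1 - v1)) (.of_forall fun q => abs_retardedTime_sub_le hv1 hlip hτ q p)
  obtain ⟨F', hF, hF'⟩ := hasFDerivAt_lightCone (p, τ p)
    (hC1.differentiable one_ne_zero (τ p)).hasDerivAt
  have hzero (q) : ‖q.1 - r2 (τ q)‖ ^ 2 - (q.2 - τ q) ^ 2 = 0 := by
    rw [← hTnorm, ← hT, sub_self]
  have heT : p.1 - r2 (τ p) = T p • e p := by
    rw [he, smul_inv_smul₀ hG.ne']
  have henorm : ‖e p‖ = 1 := by
    rw [he, norm_smul, ← hTnorm, Real.norm_of_nonneg (by positivity), inv_mul_cancel₀ hG.ne']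
  have hev : ⟪e p, v p⟫ < 1 := by
    have h := real_inner_le_norm (e p) (v p)
    rw [henorm, one_mul, hv p] at h
    rw [hv p]
    linarith [hbd (τ p)]
  have hz0 : 1 - ⟪e p, v p⟫ ≠ 0 := by linarith
  have hF'apply (dx dt ds) :
      F' ((dx, dt), ds) = 2 * T p * (⟪e p, dx⟫ - dt + ds * (1 - ⟪e p, v p⟫)) := by
    rw [hF']
    dsimp only
    rw [heT, ← hT, ← hv]
    simp only [inner_sub_right, inner_smul_right, inner_smul_left, conj_trivial]
    ring
  have hF'1 : F' (0, 1) = 2 * T p * (1 - ⟪e p, v p⟫) := by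
    rw [← Prod.mk_zero_zero, hF'apply]
    simp
  have hdτ := HasFDerivAt.of_implicit_of_isBigO_s9 hF hzero hτO (by
    rw [hF'1]
    exact mul_ne_zero (by linarith) hz0)
  rw [hF'1] at hdτ
  have hdT := (hasFDerivAt_snd (𝕜 := ℝ) (p := p)).sub hdτ
  have hdu := (hasDerivAt_inv hG.ne').comp_hasFDerivAt p
    (hdT.congr_of_eventuallyEq (.of_forall hT))
  refine ⟨_, hdu.congr_of_eventuallyEq (.of_forall hu), fun dr dt => ?_⟩
  have hsum : ∑ i : Fin 3, dr i * (-(z p * u p ^ 2 * e p i)) =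
      -(z p * u p ^ 2) * ⟪e p, dr⟫ := by
    simp only [PiLp.inner_apply, RCLike.inner_apply, conj_trivial, Finset.mul_sum]
    exact Finset.sum_congr rfl fun i _ => by ring
  rw [hsum, hz, hu]
  simp only [smul_apply, sub_apply,
    ContinuousLinearMap.comp_apply, ContinuousLinearMap.inl_apply, ContinuousLinearMap.coe_snd',
    smul_eq_mul, hF'apply]
  have hT0 := hG.ne'
  field_simp
  ring
end

section
/- Let r2 : ℝ → ℝ³ be twice continuously differentiable with ‖r2' s‖ ≤ v1 for all s ∈ ℝ, where 0 ≤ v1 < 1, and set w = r2', a = w' ∘ τ. Then at every point (r1, t) of G the field z = 1/(1 − ⟨e,v⟩) is differentiable, with time derivative Dz = u·z − 2·u·z² + z³·⟨e,a⟩ + u·z³ − u·z³·⟨v,v⟩ and spatial partial derivatives Dᵢz = −z³·eᵢ·⟨e,a⟩ − u·z³·eᵢ + u·z²·eᵢ + u·z²·vᵢ + u·z³·eᵢ·⟨v,v⟩ for i = 1,2,3. -/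
open scoped RealInnerProductSpace

/-- A retarded time of a trajectory slower than light is continuous. -/
theorem continuous_retardedTime {E : Type*} [NormedAddCommGroup E]
    {r2 : ℝ → E} {v1 : ℝ} (hv1 : v1 < 1) (hlip : ∀ s s', ‖r2 s - r2 s'‖ ≤ v1 * |s - s'|)
    {τ : E × ℝ → ℝ} (hτ : ∀ p : E × ℝ, τ p = p.2 - ‖p.1 - r2 (τ p)‖) :
    Continuous τ := by
  rw [continuous_iff_continuousAt]
  intro p
  have hpos : 0 < 1 - v1 := by linarith
  have hbound : ∀ q, dist (τ q) (τ p) ≤ (|q.2 - p.2| + ‖q.1 - p.1‖) / (1 - v1) := by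
    intro q
    rw [Real.dist_eq, le_div_iff₀ hpos]
    have h1 : |τ q - τ p| ≤ |q.2 - p.2| + ‖(q.1 - r2 (τ q)) - (p.1 - r2 (τ p))‖ := by
      have := abs_norm_sub_norm_le (q.1 - r2 (τ q)) (p.1 - r2 (τ p))
      have h3 : τ q - τ p =
          (q.2 - p.2) - (‖q.1 - r2 (τ q)‖ - ‖p.1 - r2 (τ p)‖) := by
        linarith [hτ q, hτ p]
      calc |τ q - τ p| = |(q.2 - p.2) - (‖q.1 - r2 (τ q)‖ - ‖p.1 - r2 (τ p)‖)| := by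
            rw [← h3]
        _ ≤ |q.2 - p.2| + |‖q.1 - r2 (τ q)‖ - ‖p.1 - r2 (τ p)‖| := abs_sub _ _
        _ ≤ _ := by gcongr
    have h2 : ‖(q.1 - r2 (τ q)) - (p.1 - r2 (τ p))‖ ≤ ‖q.1 - p.1‖ + v1 * |τ q - τ p| := by
      rw [sub_sub_sub_comm]
      exact (norm_sub_le _ _).trans (by gcongr; exact hlip _ _)
    linarith
  refine tendsto_iff_dist_tendsto_zero.2 (squeeze_zero (fun _ => dist_nonneg) hbound ?_)
  have hc : Continuous fun q : E × ℝ => (|q.2 - p.2| + ‖q.1 - p.1‖) / (1 - v1) := by fun_prop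
  simpa using hc.tendsto p

/-- The differential of the retarded time off the trajectory. -/
theorem hasFDerivAt_retardedTime {E : Type*} [NormedAddCommGroup E] [InnerProductSpace ℝ E]
    {r2 : ℝ → E} {τ : E × ℝ → ℝ} (hcont : Continuous τ)
    (hτ : ∀ p : E × ℝ, τ p = p.2 - ‖p.1 - r2 (τ p)‖) {p : E × ℝ} {w e : E}
    (hw : HasDerivAt r2 w (τ p)) (hne : p.1 - r2 (τ p) ≠ 0)
    (he : e = ‖p.1 - r2 (τ p)‖⁻¹ • (p.1 - r2 (τ p))) (hev : 1 - ⟪e, w⟫ ≠ 0) :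
    HasFDerivAt τ ((1 - ⟪e, w⟫)⁻¹ • (ContinuousLinearMap.snd ℝ E ℝ -
      (innerSL ℝ e).comp (ContinuousLinearMap.fst ℝ E ℝ))) p := by
  set g : E × ℝ → E × ℝ := fun q => (q.1, τ q) with hg
  set f : E × ℝ → E × ℝ := fun q => (q.1, q.2 + ‖q.1 - r2 q.2‖) with hf
  set F := ContinuousLinearMap.fst ℝ E ℝ with hF
  set S := ContinuousLinearMap.snd ℝ E ℝ with hS
  set A : E × ℝ →L[ℝ] E × ℝ := F.prod (S + (innerSL ℝ e).comp (F - S.smulRight w)) with hA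
  set τ' : E × ℝ →L[ℝ] ℝ := (1 - ⟪e, w⟫)⁻¹ • (S - (innerSL ℝ e).comp F) with hτ'
  have hdiff : HasFDerivAt (fun q : E × ℝ => q.1 - r2 q.2) (F - S.smulRight w) (g p) := by
    have h2 : HasFDerivAt (fun q : E × ℝ => r2 q.2)
        ((ContinuousLinearMap.toSpanSingleton ℝ w).comp S) (g p) :=
      HasFDerivAt.comp (g p) (f := Prod.snd) (g := r2) hw.hasFDerivAt hasFDerivAt_snd
    refine (hasFDerivAt_fst.sub h2).congr_fderiv ?_
    ext <;> simp [hF, hS]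
  have hnorm : HasFDerivAt (fun q : E × ℝ => ‖q.1 - r2 q.2‖)
      ((innerSL ℝ e).comp (F - S.smulRight w)) (g p) := by
    have h := (hdiff.norm_sq.sqrt (by simpa [hg] using hne))
    simp only [Real.sqrt_sq (norm_nonneg _)] at h
    refine h.congr_fderiv ?_
    ext q <;> simp [hg, he, hF, hS] <;> field_simp
    ring
  have hfd : HasFDerivAt f A (g p) :=
    hasFDerivAt_fst.prodMk (hasFDerivAt_snd.add hnorm)
  let B : (E × ℝ) ≃L[ℝ] (E × ℝ) := ContinuousLinearEquiv.equivOfInverse A (F.prod τ')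
    (by
      rintro ⟨x, s⟩
      simp only [hA, hτ', hF, hS]
      ext
      · simp
      · simp
        field_simp
        ring)
    (by
      rintro ⟨x, s⟩
      simp only [hA, hτ', hF, hS]
      ext
      · simp
      · simp
        field_simp
        ring)
  have hfd' : HasFDerivAt f (B : E × ℝ →L[ℝ] E × ℝ) (g p) := hfd
  have hgd : HasFDerivAt g (B.symm : E × ℝ →L[ℝ] E × ℝ) p := by
    refine HasFDerivAt.of_local_left_inverse (by fun_prop) hfd' (.of_forall fun q => ?_)
    ext
    · simp [hf, hg]
    · simp only [hf, hg]
      linarith [hτ q]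
  exact hgd.snd

/-- differentiability of the field `z = 1/(1 − ⟨e,v⟩)` on `G`, with
`Dz = u·z − 2·u·z² + z³·⟨e,a⟩ + u·z³ − u·z³·⟨v,v⟩` and
`Dᵢz = −z³·eᵢ·⟨e,a⟩ − u·z³·eᵢ + u·z²·eᵢ + u·z²·vᵢ + u·z³·eᵢ·⟨v,v⟩`. -/
theorem z_field_differential
    (r2 : ℝ → EuclideanSpace ℝ (Fin 3)) (v1 : ℝ)
    (hv0 : 0 ≤ v1) (hv1 : v1 < 1)
    (hC2 : ContDiff ℝ 2 r2) (hbd : ∀ s : ℝ, ‖deriv r2 s‖ ≤ v1)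
    (τ : EuclideanSpace ℝ (Fin 3) × ℝ → ℝ)
    (hτ : ∀ p : EuclideanSpace ℝ (Fin 3) × ℝ, τ p = p.2 - ‖p.1 - r2 (τ p)‖)
    (T : EuclideanSpace ℝ (Fin 3) × ℝ → ℝ)
    (hT : ∀ p, T p = p.2 - τ p)
    (u : EuclideanSpace ℝ (Fin 3) × ℝ → ℝ)
    (hu : ∀ p, u p = (T p)⁻¹)
    (e : EuclideanSpace ℝ (Fin 3) × ℝ → EuclideanSpace ℝ (Fin 3))
    (he : ∀ p, e p = (T p)⁻¹ • (p.1 - r2 (τ p)))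
    (v : EuclideanSpace ℝ (Fin 3) × ℝ → EuclideanSpace ℝ (Fin 3))
    (hv : ∀ p, v p = deriv r2 (τ p))
    (a : EuclideanSpace ℝ (Fin 3) × ℝ → EuclideanSpace ℝ (Fin 3))
    (ha : ∀ p, a p = deriv (deriv r2) (τ p))
    (z : EuclideanSpace ℝ (Fin 3) × ℝ → ℝ)
    (hz : ∀ p, z p = (1 - ⟪e p, v p⟫)⁻¹)
    (r1 : EuclideanSpace ℝ (Fin 3)) (t : ℝ)
    (hG : 0 < T (r1, t)) :
    ∃ L : EuclideanSpace ℝ (Fin 3) × ℝ →L[ℝ] ℝ,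
      HasFDerivAt z L (r1, t) ∧
        ∀ (dr : EuclideanSpace ℝ (Fin 3)) (dt : ℝ),
          L (dr, dt) =
            dt * (u (r1, t) * z (r1, t) - 2 * u (r1, t) * z (r1, t) ^ 2
                + z (r1, t) ^ 3 * ⟪e (r1, t), a (r1, t)⟫
                + u (r1, t) * z (r1, t) ^ 3
                - u (r1, t) * z (r1, t) ^ 3 * ⟪v (r1, t), v (r1, t)⟫) +
              ∑ i : Fin 3, dr i *
                (-(z (r1, t) ^ 3 * e (r1, t) i * ⟪e (r1, t), a (r1, t)⟫)
                  - u (r1, t) * z (r1, t) ^ 3 * e (r1, t) i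
                  + u (r1, t) * z (r1, t) ^ 2 * e (r1, t) i
                  + u (r1, t) * z (r1, t) ^ 2 * v (r1, t) i
                  + u (r1, t) * z (r1, t) ^ 3 * e (r1, t) i * ⟪v (r1, t), v (r1, t)⟫) := by
  set p : EuclideanSpace ℝ (Fin 3) × ℝ := (r1, t) with hp
  have hd : Differentiable ℝ r2 := hC2.differentiable (by norm_num)
  have hd2 : Differentiable ℝ (deriv r2) :=
    ((contDiff_succ_iff_deriv (n := 1)).1 hC2).2.2.differentiable (by norm_num)
  have hlip : ∀ s s', ‖r2 s - r2 s'‖ ≤ v1 * |s - s'| := fun s s' =>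
    convex_univ.norm_image_sub_le_of_norm_deriv_le (fun x _ => hd x) (fun x _ => hbd x)
      (Set.mem_univ s') (Set.mem_univ s)
  have hcont : Continuous τ := continuous_retardedTime hv1 hlip hτ
  have hTn : T p = ‖p.1 - r2 (τ p)‖ := by linarith [hT p, hτ p]
  have hne : p.1 - r2 (τ p) ≠ 0 := norm_pos_iff.1 (hTn ▸ hG)
  have he1 : ‖e p‖ = 1 := by
    rw [he, norm_smul, ← hTn, Real.norm_of_nonneg (inv_nonneg.2 hG.le), inv_mul_cancel₀ hG.ne']
  have hev : 0 < 1 - ⟪e p, v p⟫ := by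
    have h1 := real_inner_le_norm (e p) (v p)
    have h2 := hbd (τ p)
    rw [← hv] at h2
    rw [he1, one_mul] at h1
    linarith
  have hw : HasDerivAt r2 (v p) (τ p) := by rw [hv]; exact (hd _).hasDerivAt
  have ha' : HasDerivAt (deriv r2) (a p) (τ p) := by rw [ha]; exact (hd2 _).hasDerivAt
  have hτd := hasFDerivAt_retardedTime hcont hτ hw hne (by rw [he, hTn]) hev.ne'
  have hTd : HasFDerivAt T _ p :=
    (hasFDerivAt_snd.sub hτd).congr_of_eventuallyEq (.of_forall hT)
  have hTi : HasFDerivAt (fun q => (T q)⁻¹) _ p :=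
    (hasDerivAt_inv hG.ne').comp_hasFDerivAt p hTd
  have hrd : HasFDerivAt (fun q => q.1 - r2 (τ q)) _ p :=
    hasFDerivAt_fst.sub (hw.hasFDerivAt.comp p hτd)
  have hed : HasFDerivAt e _ p := (hTi.smul hrd).congr_of_eventuallyEq (.of_forall he)
  have hvd : HasFDerivAt v _ p :=
    (ha'.hasFDerivAt.comp p hτd).congr_of_eventuallyEq (.of_forall hv)
  have hzd : HasFDerivAt z _ p :=
    ((hasDerivAt_inv hev.ne').comp_hasFDerivAt p
      ((hasFDerivAt_const (1 : ℝ) p).sub (hed.inner ℝ hvd))).congr_of_eventuallyEq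
      (.of_forall hz)
  refine ⟨_, hzd, fun dr dt => ?_⟩
  have hR : p.1 - r2 (τ p) = T p • e p := by rw [he, smul_inv_smul₀ hG.ne']
  have hsum : ∀ c d : ℝ, ∑ i : Fin 3, dr i * (c * e p i + d * v p i)
      = c * ⟪e p, dr⟫ + d * ⟪v p, dr⟫ := by
    intro c d
    simp only [PiLp.inner_apply, RCLike.inner_apply, conj_trivial, Finset.mul_sum,
      ← Finset.sum_add_distrib]
    exact Finset.sum_congr rfl fun i _ => by ring
  have hz' : ⟪e p, v p⟫ = 1 - (z p)⁻¹ := by rw [hz, inv_inv]; ring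
  have hz0 : z p ≠ 0 := by rw [hz]; exact inv_ne_zero hev.ne'
  have hT0 : T p ≠ 0 := hG.ne'
  rw [Finset.sum_congr rfl (g := fun i => dr i *
      ((-(z p ^ 3 * ⟪e p, a p⟫) - u p * z p ^ 3 + u p * z p ^ 2
        + u p * z p ^ 3 * ⟪v p, v p⟫) * e p i + u p * z p ^ 2 * v p i))
      (fun i _ => by ring), hsum, hu]
  simp [hR, inner_add_left, inner_sub_left, inner_smul_left, inner_smul_right,
    real_inner_comm (v p) dr]
  simp only [inner_sub_right, inner_smul_right, hz', sub_sub_cancel, inv_inv]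
  field_simp
  ring
end

section
/- Let r2 : ℝ → ℝ³ satisfy ‖r2 s − r2 s'‖ ≤ v1·|s − s'| for all s, s' ∈ ℝ with 0 ≤ v1 < 1. Define φ on G by φ(r1, t) = (τ(r1,t), T(r1,t), e(r1,t)). Then φ maps G bijectively onto G₁ = ℝ × (0, ∞) × S², where S² = {x ∈ ℝ³ : ‖x‖ = 1}, and its inverse is the map ψ given by ψ(σ, T, e) = (r2 σ + T·e, σ + T); that is, ψ(φ(r1,t)) = (r1,t) for all (r1,t) ∈ G and φ(ψ(σ,T,e)) = (σ,T,e) for all (σ,T,e) ∈ G₁. -/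
/-- A retarded time along a trajectory of speed at most `v < 1` is unique. -/
theorem retarded_time_unique {E : Type*} [SeminormedAddCommGroup E] {γ : ℝ → E} {v : ℝ}
    (hv : v < 1) (hγ : ∀ s s' : ℝ, ‖γ s - γ s'‖ ≤ v * |s - s'|) {x : E} {t a b : ℝ}
    (ha : a = t - ‖x - γ a‖) (hb : b = t - ‖x - γ b‖) : a = b := by
  have hab : |a - b| ≤ v * |a - b| :=
    calc |a - b| = |‖x - γ b‖ - ‖x - γ a‖| := by congr 1; linarith
      _ ≤ ‖(x - γ b) - (x - γ a)‖ := abs_norm_sub_norm_le _ _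
      _ = ‖γ a - γ b‖ := by rw [sub_sub_sub_cancel_left]
      _ ≤ v * |a - b| := hγ a b
  by_contra hne
  have hpos : 0 < |a - b| := abs_pos.mpr (sub_ne_zero.mpr hne)
  nlinarith

/-- `φ = (τ, T, e)` maps `G` bijectively onto
`G₁ = ℝ × (0,∞) × S²`, with inverse `ψ(σ,T,e) = (r2 σ + T·e, σ + T)`. -/
theorem phi_bijection_onto_G1
    (r2 : ℝ → EuclideanSpace ℝ (Fin 3)) (v1 : ℝ)
    (hv0 : 0 ≤ v1) (hv1 : v1 < 1)
    (hlip : ∀ s s' : ℝ, ‖r2 s - r2 s'‖ ≤ v1 * |s - s'|)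
    (τ : EuclideanSpace ℝ (Fin 3) × ℝ → ℝ)
    (hτ : ∀ p : EuclideanSpace ℝ (Fin 3) × ℝ, τ p = p.2 - ‖p.1 - r2 (τ p)‖)
    (G : Set (EuclideanSpace ℝ (Fin 3) × ℝ))
    (hG : G = {p : EuclideanSpace ℝ (Fin 3) × ℝ | 0 < p.2 - τ p})
    (G1 : Set (ℝ × ℝ × EuclideanSpace ℝ (Fin 3)))
    (hG1 : G1 = (Set.univ : Set ℝ) ×ˢ
      (Set.Ioi (0 : ℝ) ×ˢ Metric.sphere (0 : EuclideanSpace ℝ (Fin 3)) 1))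
    (φ : EuclideanSpace ℝ (Fin 3) × ℝ → ℝ × ℝ × EuclideanSpace ℝ (Fin 3))
    (hφ : ∀ p, φ p = (τ p, p.2 - τ p, (p.2 - τ p)⁻¹ • (p.1 - r2 (τ p))))
    (ψ : ℝ × ℝ × EuclideanSpace ℝ (Fin 3) → EuclideanSpace ℝ (Fin 3) × ℝ)
    (hψ : ∀ q : ℝ × ℝ × EuclideanSpace ℝ (Fin 3),
      ψ q = (r2 q.1 + q.2.1 • q.2.2, q.1 + q.2.1)) :
    Set.BijOn φ G G1 ∧
      (∀ p ∈ G, ψ (φ p) = p) ∧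
      (∀ q ∈ G1, ψ q ∈ G ∧ φ (ψ q) = q) := by
  subst hG hG1
  have maps : ∀ p : EuclideanSpace ℝ (Fin 3) × ℝ, 0 < p.2 - τ p →
      φ p ∈ (Set.univ : Set ℝ) ×ˢ
        (Set.Ioi (0 : ℝ) ×ˢ Metric.sphere (0 : EuclideanSpace ℝ (Fin 3)) 1) := by
    intro p hp
    have hnorm : ‖p.1 - r2 (τ p)‖ = p.2 - τ p := by linarith [hτ p]
    rw [hφ]
    refine ⟨Set.mem_univ _, hp, ?_⟩
    rw [mem_sphere_zero_iff_norm, norm_smul, hnorm, norm_inv, Real.norm_of_nonneg hp.le,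
      inv_mul_cancel₀ hp.ne']
  have left_inv : ∀ p : EuclideanSpace ℝ (Fin 3) × ℝ, 0 < p.2 - τ p → ψ (φ p) = p := by
    intro p hp
    rw [hψ, hφ]
    refine Prod.ext ?_ ?_
    · simp [smul_inv_smul₀ hp.ne']
    · simp
  have right_inv : ∀ q ∈ (Set.univ : Set ℝ) ×ˢ
      (Set.Ioi (0 : ℝ) ×ˢ Metric.sphere (0 : EuclideanSpace ℝ (Fin 3)) 1),
      0 < (ψ q).2 - τ (ψ q) ∧ φ (ψ q) = q := by
    rintro ⟨σ, T, e⟩ ⟨-, hT, he⟩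
    replace hT : 0 < T := hT
    replace he : ‖e‖ = 1 := mem_sphere_zero_iff_norm.mp he
    have hretarded : τ (ψ (σ, T, e)) = σ := by
      refine retarded_time_unique hv1 hlip (hτ _) ?_
      simp [hψ, norm_smul, he, abs_of_pos hT]
    rw [hφ, hretarded, hψ]
    simp [hT, inv_smul_smul₀ hT.ne']
  exact ⟨⟨maps, Set.LeftInvOn.injOn left_inv,
    fun q hq => ⟨ψ q, (right_inv q hq).1, (right_inv q hq).2⟩⟩, left_inv, right_inv⟩
end

section
/- Let r2 : ℝ → ℝ³ be twice continuously differentiable with ‖r2' s‖ ≤ v1 for all s ∈ ℝ, where 0 ≤ v1 < 1. Define on G the Liénard–Wiechert potentials A = u·z·v (a vector field) and φ = u·z (a scalar field). Then the Lorentz gauge condition holds on G: ∇·A + Dφ = 0, i.e. D₁A₁ + D₂A₂ + D₃A₃ + Dφ = 0 at every point of G. -/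
open scoped RealInnerProductSpace

/-- Partial derivative with respect to time of a scalar field on `ℝ³ × ℝ`. -/
noncomputable def Dt (f : EuclideanSpace ℝ (Fin 3) × ℝ → ℝ)
    (p : EuclideanSpace ℝ (Fin 3) × ℝ) : ℝ :=
  deriv (fun s : ℝ => f (p.1, s)) p.2

/-- Partial derivative with respect to the `i`-th space coordinate of a scalar
field on `ℝ³ × ℝ`. -/
noncomputable def Dx (i : Fin 3) (f : EuclideanSpace ℝ (Fin 3) × ℝ → ℝ)
    (p : EuclideanSpace ℝ (Fin 3) × ℝ) : ℝ :=
  deriv (fun h : ℝ => f (p.1 + h • EuclideanSpace.single i (1 : ℝ), p.2)) 0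

namespace LienardWiechert

variable {E : Type*} [NormedAddCommGroup E]

/-- The retarded time is continuous: it is Lipschitz with constant `2 / (1 - c)`. -/
theorem continuous_retardedTime {r : ℝ → E} {c : ℝ} (hc : c < 1)
    (hr : ∀ s s', ‖r s - r s'‖ ≤ c * |s - s'|) {τ : E × ℝ → ℝ}
    (hτ : ∀ p, τ p = p.2 - ‖p.1 - r (τ p)‖) : Continuous τ := by
  have hc' : 0 < 1 - c := sub_pos.2 hc
  refine (LipschitzWith.of_dist_le_mul (K := (2 / (1 - c)).toNNReal) fun p q => ?_).continuous
  rw [Real.coe_toNNReal _ (by positivity), Real.dist_eq, dist_eq_norm, div_mul_eq_mul_div,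
    le_div_iff₀ hc']
  have h1 : ‖p.1 - q.1‖ ≤ ‖p - q‖ := norm_fst_le (p - q)
  have h2 : |p.2 - q.2| ≤ ‖p - q‖ := norm_snd_le (p - q)
  have h3 : |‖p.1 - r (τ p)‖ - ‖q.1 - r (τ q)‖| ≤ ‖p.1 - q.1‖ + c * |τ p - τ q| := by
    calc _ ≤ ‖(p.1 - r (τ p)) - (q.1 - r (τ q))‖ := abs_norm_sub_norm_le _ _
      _ = ‖(p.1 - q.1) - (r (τ p) - r (τ q))‖ := by congr 1; abel
      _ ≤ ‖p.1 - q.1‖ + ‖r (τ p) - r (τ q)‖ := norm_sub_le _ _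
      _ ≤ _ := by gcongr; exact hr _ _
  have h4 : |τ p - τ q| ≤ |p.2 - q.2| + |‖p.1 - r (τ p)‖ - ‖q.1 - r (τ q)‖| := by
    have : τ p - τ q = (p.2 - q.2) - (‖p.1 - r (τ p)‖ - ‖q.1 - r (τ q)‖) := by
      linarith [hτ p, hτ q]
    rw [this]
    exact abs_sub _ _
  linarith

variable [InnerProductSpace ℝ E]

theorem hasFDerivAt_norm {x : E} (hx : x ≠ 0) :
    HasFDerivAt (fun y : E => ‖y‖) (‖x‖⁻¹ • innerSL ℝ x) x := by
  have h := (hasStrictFDerivAt_norm_sq x).hasFDerivAt.sqrt (by simpa using hx)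
  simp only [Real.sqrt_sq (norm_nonneg _)] at h
  convert! h using 1
  ext w
  simp
  field_simp

/-- Implicit differentiation of the retarded time off the trajectory. -/
theorem hasFDerivAt_retardedTime {r : ℝ → E} {τ : E × ℝ → ℝ}
    (hτ : ∀ p, τ p = p.2 - ‖p.1 - r (τ p)‖) {p : E × ℝ} (hcont : ContinuousAt τ p)
    {v : E} (hv : HasDerivAt r v (τ p)) (hR : p.1 - r (τ p) ≠ 0)
    (hK : ‖p.1 - r (τ p)‖ - ⟪p.1 - r (τ p), v⟫ ≠ 0) :
    HasFDerivAt τ ((‖p.1 - r (τ p)‖ - ⟪p.1 - r (τ p), v⟫)⁻¹ •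
      (‖p.1 - r (τ p)‖ • ContinuousLinearMap.snd ℝ E ℝ -
        (innerSL ℝ (p.1 - r (τ p))).comp (ContinuousLinearMap.fst ℝ E ℝ))) p := by
  set R := p.1 - r (τ p) with hRdef
  have hn : ‖R‖ ≠ 0 := norm_ne_zero_iff.2 hR
  have hpos : HasFDerivAt (fun q : E × ℝ => q.1 - r q.2)
      (ContinuousLinearMap.fst ℝ E ℝ - (ContinuousLinearMap.snd ℝ E ℝ).smulRight v)
      (p.1, τ p) := by
    have h := hasFDerivAt_fst.sub
      (hv.hasFDerivAt.comp (p.1, τ p) (hasFDerivAt_snd (𝕜 := ℝ) (E := E) (p := (p.1, τ p))))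
    convert! h using 1
  have hf := hasFDerivAt_fst.prodMk ((hasFDerivAt_snd (𝕜 := ℝ) (E := E) (p := (p.1, τ p))).add
    ((hasFDerivAt_norm hR).comp (p.1, τ p) hpos))
  have hg : ContinuousAt (fun q : E × ℝ => (q.1, τ q)) p := continuousAt_fst.prodMk hcont
  have h := HasFDerivAt.of_comp_of_leftInverse (g := fun q : E × ℝ => (q.1, τ q)) (a := p)
    (f'symm := (ContinuousLinearMap.fst ℝ E ℝ).prod ((‖R‖ - ⟪R, v⟫)⁻¹ •
      (‖R‖ • ContinuousLinearMap.snd ℝ E ℝ -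
        (innerSL ℝ R).comp (ContinuousLinearMap.fst ℝ E ℝ)))) hg hf (hasFDerivAt_id p)
    (Filter.Eventually.of_forall fun q => by
      have := hτ q
      ext <;> simp
      linarith) (by
      rintro ⟨w, s⟩
      simp
      field_simp
      ring)
  exact hasFDerivAt_snd.comp p h

theorem hasFDerivAt_denominator {r : ℝ → E} {τ : E × ℝ → ℝ}
    {p : E × ℝ} {a : E} {τ' : E × ℝ →L[ℝ] ℝ} (hτ : HasFDerivAt τ τ' p)
    (hr : HasDerivAt r (deriv r (τ p)) (τ p)) (ha : HasDerivAt (deriv r) a (τ p)) :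
    ∃ K' : E × ℝ →L[ℝ] ℝ,
      HasFDerivAt (fun q => q.2 - τ q - ⟪q.1 - r (τ q), deriv r (τ q)⟫) K' p ∧
      ∀ w s, K' (w, s) = s - τ' (w, s) - (⟪p.1 - r (τ p), τ' (w, s) • a⟫ +
        ⟪w - τ' (w, s) • deriv r (τ p), deriv r (τ p)⟫) := by
  refine ⟨_, (hasFDerivAt_snd.sub hτ).sub
    ((hasFDerivAt_fst.sub (hr.hasFDerivAt.comp p hτ)).inner ℝ (ha.hasFDerivAt.comp p hτ)), ?_⟩
  intro w s
  simp

theorem Dt_eq_of_hasFDerivAt {f : EuclideanSpace ℝ (Fin 3) × ℝ → ℝ}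
    {f' : EuclideanSpace ℝ (Fin 3) × ℝ →L[ℝ] ℝ} {p : EuclideanSpace ℝ (Fin 3) × ℝ}
    (hf : HasFDerivAt f f' p) : Dt f p = f' (0, 1) :=
  (hf.comp_hasDerivAt p.2 ((hasDerivAt_const p.2 p.1).prodMk (hasDerivAt_id p.2))).deriv

theorem Dx_eq_of_hasFDerivAt {f : EuclideanSpace ℝ (Fin 3) × ℝ → ℝ}
    {f' : EuclideanSpace ℝ (Fin 3) × ℝ →L[ℝ] ℝ} {p : EuclideanSpace ℝ (Fin 3) × ℝ}
    (hf : HasFDerivAt f f' p) (i : Fin 3) :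
    Dx i f p = f' (EuclideanSpace.single i 1, 0) := by
  have hline : HasDerivAt (fun h : ℝ => (p.1 + h • EuclideanSpace.single i (1 : ℝ), p.2))
      (EuclideanSpace.single i (1 : ℝ), (0 : ℝ)) 0 := by
    have h := (((hasDerivAt_id (0 : ℝ)).smul_const (EuclideanSpace.single i (1 : ℝ))).const_add
      p.1).prodMk (hasDerivAt_const (0 : ℝ) p.2)
    simpa using h
  exact (hf.comp_hasDerivAt_of_eq 0 hline (by simp)).deriv

end LienardWiechert

/-- the Liénard–Wiechert potentials `A = u·z·v`, `φ = u·z`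
satisfy the Lorentz gauge condition `∇·A + Dφ = 0` on `G`. -/
theorem lienard_wiechert_lorentz_gauge
    (r2 : ℝ → EuclideanSpace ℝ (Fin 3)) (v1 : ℝ)
    (hv0 : 0 ≤ v1) (hv1 : v1 < 1)
    (hC2 : ContDiff ℝ 2 r2) (hbd : ∀ s : ℝ, ‖deriv r2 s‖ ≤ v1)
    (τ : EuclideanSpace ℝ (Fin 3) × ℝ → ℝ)
    (hτ : ∀ p : EuclideanSpace ℝ (Fin 3) × ℝ, τ p = p.2 - ‖p.1 - r2 (τ p)‖)
    (T : EuclideanSpace ℝ (Fin 3) × ℝ → ℝ)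
    (hT : ∀ p, T p = p.2 - τ p)
    (u : EuclideanSpace ℝ (Fin 3) × ℝ → ℝ)
    (hu : ∀ p, u p = (T p)⁻¹)
    (e : EuclideanSpace ℝ (Fin 3) × ℝ → EuclideanSpace ℝ (Fin 3))
    (he : ∀ p, e p = (T p)⁻¹ • (p.1 - r2 (τ p)))
    (v : EuclideanSpace ℝ (Fin 3) × ℝ → EuclideanSpace ℝ (Fin 3))
    (hv : ∀ p, v p = deriv r2 (τ p))
    (z : EuclideanSpace ℝ (Fin 3) × ℝ → ℝ)
    (hz : ∀ p, z p = (1 - ⟪e p, v p⟫)⁻¹)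
    (A : EuclideanSpace ℝ (Fin 3) × ℝ → EuclideanSpace ℝ (Fin 3))
    (hA : ∀ p, A p = (u p * z p) • v p)
    (φ : EuclideanSpace ℝ (Fin 3) × ℝ → ℝ)
    (hφ : ∀ p, φ p = u p * z p)
    (r1 : EuclideanSpace ℝ (Fin 3)) (t : ℝ)
    (hG : 0 < T (r1, t)) :
    (∑ i : Fin 3, Dx i (fun p => A p i) (r1, t)) + Dt φ (r1, t) = 0 := by
  have hr : ∀ s, HasDerivAt r2 (deriv r2 s) s := fun s =>
    (hC2.differentiable (by norm_num)).differentiableAt.hasDerivAt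
  have hd : Differentiable ℝ (deriv r2) :=
    ((contDiff_succ_iff_deriv (n := 1)).1 hC2).2.2.differentiable (by norm_num)
  have hLip : ∀ s s', ‖r2 s - r2 s'‖ ≤ v1 * |s - s'| := fun s s' =>
    convex_univ.norm_image_sub_le_of_norm_deriv_le (fun x _ => (hr x).differentiableAt)
      (fun x _ => hbd x) (Set.mem_univ s') (Set.mem_univ s)
  set p : EuclideanSpace ℝ (Fin 3) × ℝ := (r1, t) with hp
  have hTn : ∀ q, T q = ‖q.1 - r2 (τ q)‖ := fun q => by rw [hT]; linarith [hτ q]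
  have hR : p.1 - r2 (τ p) ≠ 0 := norm_pos_iff.1 (hTn p ▸ hG)
  have hKpos : 0 < ‖p.1 - r2 (τ p)‖ - ⟪p.1 - r2 (τ p), deriv r2 (τ p)⟫ := by
    have h1 := real_inner_le_norm (p.1 - r2 (τ p)) (deriv r2 (τ p))
    have h2 := mul_le_mul_of_nonneg_left (hbd (τ p)) (norm_nonneg (p.1 - r2 (τ p)))
    nlinarith [norm_pos_iff.2 hR]
  have hτ' := LienardWiechert.hasFDerivAt_retardedTime hτ
    (LienardWiechert.continuous_retardedTime hv1 hLip hτ).continuousAt (hr (τ p)) hR hKpos.ne'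
  obtain ⟨K', hK', hK'_apply⟩ :=
    LienardWiechert.hasFDerivAt_denominator hτ' (hr (τ p)) (hd (τ p)).hasDerivAt
  have huz : ∀ q, u q * z q = (q.2 - τ q - ⟪q.1 - r2 (τ q), deriv r2 (τ q)⟫)⁻¹ := by
    intro q
    rw [hu, hz, he, hv, ← hT, ← mul_inv, inner_smul_left]
    rcases eq_or_ne (T q) 0 with h | h
    · have : q.1 - r2 (τ q) = 0 := norm_eq_zero.1 (hTn q ▸ h)
      simp [h, this]
    · congr 1
      simp
      field_simp
  set K := fun q : EuclideanSpace ℝ (Fin 3) × ℝ =>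
    q.2 - τ q - ⟪q.1 - r2 (τ q), deriv r2 (τ q)⟫ with hK
  have hKp : K p = ‖p.1 - r2 (τ p)‖ - ⟪p.1 - r2 (τ p), deriv r2 (τ p)⟫ := by
    simp only [hK, ← hTn, hT]
  have hKp0 : K p ≠ 0 := hKp ▸ hKpos.ne'
  have hinv := (hasDerivAt_inv hKp0).comp_hasFDerivAt p hK'
  have hφ' : HasFDerivAt φ _ p := hinv.congr_of_eventuallyEq
    (Filter.Eventually.of_forall fun q => by rw [hφ, huz]; rfl)
  have hA' : ∀ i : Fin 3, HasFDerivAt (fun q => A q i) _ p := fun i =>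
    (hinv.mul ((EuclideanSpace.proj (𝕜 := ℝ) i).hasFDerivAt.comp p
      ((hd (τ p)).hasDerivAt.hasFDerivAt.comp p hτ'))).congr_of_eventuallyEq
    (Filter.Eventually.of_forall fun q => by simp only [hA, hv, huz]; rfl)
  rw [LienardWiechert.Dt_eq_of_hasFDerivAt hφ']
  simp only [fun i => LienardWiechert.Dx_eq_of_hasFDerivAt (hA' i) i]
  rw [← hKp] at hK'_apply
  simp only [← hKp]
  have hnorm : ‖p.1 - r2 (τ p)‖ = K p + ⟪p.1 - r2 (τ p), deriv r2 (τ p)⟫ := by rw [hKp]; ring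
  simp only [Fin.sum_univ_three, add_apply, smul_apply, Function.comp_apply,
    ContinuousLinearMap.comp_apply, hK'_apply, hnorm]
  generalize p.1 - r2 (τ p) = R
  generalize deriv (deriv r2) (τ p) = a
  generalize deriv r2 (τ p) = w
  generalize K p = k at hKp0 ⊢
  simp [PiLp.inner_apply, Fin.sum_univ_three]
  field_simp
  ring
end

section
/- Let r2 : ℝ → ℝ³ be twice continuously differentiable with ‖r2' s‖ ≤ v1 for all s ∈ ℝ, where 0 ≤ v1 < 1. Define on G the potentials A = u·z·v and φ = u·z, and the field E = −∇φ − DA (i.e. Eᵢ = −Dᵢφ − DAᵢ). Then at every point of G one has the explicit representation E = −u·z²·a + u·z³·⟨e,a⟩·e − u·z³·⟨e,a⟩·v + u²·z³·e − u²·z³·⟨v,v⟩·e − u²·z³·v + u²·z³·⟨v,v⟩·v. -/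
open scoped RealInnerProductSpace

open Filter Topology

section RetardedTime

variable {V : Type*} [NormedAddCommGroup V]
  {r X : ℝ → V} {θ σ : ℝ → ℝ} {v₁ c s : ℝ} {d : V}

/-- A retarded time along a continuous curve of events is continuous. -/
theorem continuousAt_retardedTime (hv₁ : v₁ < 1)
    (hr : ∀ x y, ‖r x - r y‖ ≤ v₁ * |x - y|)
    (hσ : ∀ h, σ h = θ h - ‖X h - r (σ h)‖)
    (hX : ContinuousAt X s) (hθ : ContinuousAt θ s) : ContinuousAt σ s := by
  have hpos : 0 < 1 - v₁ := by linarith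
  have key (h : ℝ) : |σ h - σ s| ≤ (|θ h - θ s| + ‖X h - X s‖) / (1 - v₁) := by
    rw [le_div_iff₀ hpos]
    have h1 : σ h - σ s = (θ h - θ s) - (‖X h - r (σ h)‖ - ‖X s - r (σ s)‖) := by
      linarith [hσ h, hσ s]
    have h2 : |σ h - σ s| ≤ |θ h - θ s| + |‖X h - r (σ h)‖ - ‖X s - r (σ s)‖| := by
      conv_lhs => rw [h1]
      exact abs_sub _ _
    have h3 := abs_norm_sub_norm_le (X h - r (σ h)) (X s - r (σ s))
    have h4 : ‖(X h - r (σ h)) - (X s - r (σ s))‖ ≤ ‖X h - X s‖ + ‖r (σ h) - r (σ s)‖ := by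
      rw [sub_sub_sub_comm]
      exact norm_sub_le _ _
    linarith [hr (σ h) (σ s)]
  have lim : Tendsto (fun h => (|θ h - θ s| + ‖X h - X s‖) / (1 - v₁)) (𝓝 s) (𝓝 0) := by
    have : ContinuousAt (fun h => (|θ h - θ s| + ‖X h - X s‖) / (1 - v₁)) s := by fun_prop
    simpa [ContinuousAt] using this
  rw [ContinuousAt, tendsto_iff_norm_sub_tendsto_zero]
  exact squeeze_zero (fun _ => norm_nonneg _) key lim

variable [InnerProductSpace ℝ V]

/-- Derivative of the retarded time along a differentiable curve of events. -/
theorem hasDerivAt_retardedTime (hv₁ : v₁ < 1) (hr : Differentiable ℝ r)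
    (hbd : ∀ x, ‖deriv r x‖ ≤ v₁)
    (hσ : ∀ h, σ h = θ h - ‖X h - r (σ h)‖)
    (hX : HasDerivAt X d s) (hθ : HasDerivAt θ c s)
    (hK : θ s - σ s - ⟪X s - r (σ s), deriv r (σ s)⟫ ≠ 0) :
    HasDerivAt σ (((θ s - σ s) * c - ⟪X s - r (σ s), d⟫) /
      (θ s - σ s - ⟪X s - r (σ s), deriv r (σ s)⟫)) s := by
  have hlip (x y : ℝ) : ‖r x - r y‖ ≤ v₁ * |x - y| :=
    Convex.norm_image_sub_le_of_norm_deriv_le (fun z _ => hr z) (fun z _ => hbd z)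
      convex_univ (Set.mem_univ y) (Set.mem_univ x)
  have hσc := continuousAt_retardedTime hv₁ hlip hσ hX.continuousAt hθ.continuousAt
  have hXc := hX.continuousAt
  have hθc := hθ.continuousAt
  have hrc : ContinuousAt (fun h => r (σ h)) s := (hr _).continuousAt.comp hσc
  have hρ : ContinuousAt (fun h => dslope r (σ s) (σ h)) s :=
    (continuousAt_dslope_same.2 (hr (σ s))).comp hσc
  have hdX : ContinuousAt (dslope X s) s := continuousAt_dslope_same.2 hX.differentiableAt
  have hdθ : ContinuousAt (dslope θ s) s := continuousAt_dslope_same.2 hθ.differentiableAt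
  set P : ℝ → ℝ := fun h => (θ h - σ h) + (θ s - σ s)
  set Q : ℝ → V := fun h => (X h - r (σ h)) + (X s - r (σ s))
  set den : ℝ → ℝ := fun h => P h - ⟪Q h, dslope r (σ s) (σ h)⟫
  set num : ℝ → ℝ := fun h => P h * dslope θ s h - ⟪Q h, dslope X s h⟫
  have hP : ContinuousAt P s := by fun_prop
  have hQ : ContinuousAt Q s := (hXc.sub hrc).add continuousAt_const
  have hden : ContinuousAt den s := hP.sub (hQ.inner hρ)
  have hnum : ContinuousAt num s := (hP.mul hdθ).sub (hQ.inner hdX)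
  have hden_s : den s = 2 * (θ s - σ s - ⟪X s - r (σ s), deriv r (σ s)⟫) := by
    simp only [den, P, Q, dslope_same, inner_add_left]
    ring
  have hnum_s : num s = 2 * ((θ s - σ s) * c - ⟪X s - r (σ s), d⟫) := by
    simp only [num, P, Q, dslope_same, inner_add_left, hX.deriv, hθ.deriv]
    ring
  have hden0 : den s ≠ 0 := by
    rw [hden_s]
    exact mul_ne_zero two_ne_zero hK
  have key (h : ℝ) : (σ h - σ s) * den h = (h - s) * num h := by
    have e1 : θ h - θ s = (h - s) * dslope θ s h := (sub_smul_dslope θ s h).symm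
    have e2 : X h - X s = (h - s) • dslope X s h := (sub_smul_dslope X s h).symm
    have e3 : r (σ h) - r (σ s) = (σ h - σ s) • dslope r (σ s) (σ h) :=
      (sub_smul_dslope r (σ s) (σ h)).symm
    have sq (k : ℝ) : (θ k - σ k) ^ 2 = ⟪X k - r (σ k), X k - r (σ k)⟫ := by
      rw [real_inner_self_eq_norm_sq, show θ k - σ k = ‖X k - r (σ k)‖ by linarith [hσ k]]
    have diff : ⟪Q h, (X h - X s) - (r (σ h) - r (σ s))⟫ =
        (θ h - σ h) ^ 2 - (θ s - σ s) ^ 2 := by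
      rw [sq h, sq s, sub_sub_sub_comm]
      simp only [Q]
      generalize X h - r (σ h) = R₁, X s - r (σ s) = R₀
      rw [inner_add_left, inner_sub_right, inner_sub_right, real_inner_comm R₁ R₀]
      ring
    rw [e2, e3, inner_sub_right, real_inner_smul_right, real_inner_smul_right] at diff
    simp only [den, num]
    have : (θ h - σ h) ^ 2 - (θ s - σ s) ^ 2 = P h * ((θ h - θ s) - (σ h - σ s)) := by
      simp only [P]
      ring
    rw [this, e1] at diff
    linarith
  rw [hasDerivAt_iff_tendsto_slope]
  have lim : Tendsto (fun h => num h / den h) (𝓝[≠] s) (𝓝 (num s / den s)) :=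
    (hnum.div hden hden0).tendsto.mono_left nhdsWithin_le_nhds
  rw [hnum_s, hden_s, mul_div_mul_left _ _ two_ne_zero] at lim
  refine lim.congr' ?_
  filter_upwards [self_mem_nhdsWithin, nhdsWithin_le_nhds (hden.eventually_ne hden0)] with h hne hd
  have hne' : h - s ≠ 0 := sub_ne_zero.2 hne
  rw [slope_def_field, div_eq_div_iff hd hne']
  linarith [key h]

/-- Derivative of the Liénard–Wiechert denominator along a differentiable curve of events. -/
theorem hasDerivAt_retardedDenominator {σ' : ℝ} (hr : ContDiff ℝ 2 r)
    (hX : HasDerivAt X d s) (hθ : HasDerivAt θ c s) (hσ : HasDerivAt σ σ' s) :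
    HasDerivAt (fun h => θ h - σ h - ⟪X h - r (σ h), deriv r (σ h)⟫)
      (c - σ' - (⟪d, deriv r (σ s)⟫ - σ' * ⟪deriv r (σ s), deriv r (σ s)⟫
        + σ' * ⟪X s - r (σ s), deriv (deriv r) (σ s)⟫)) s := by
  have hr1 : HasDerivAt (fun h => r (σ h)) (σ' • deriv r (σ s)) s :=
    ((hr.differentiable two_ne_zero) (σ s)).hasDerivAt.scomp s hσ
  have hr2 : HasDerivAt (fun h => deriv r (σ h)) (σ' • deriv (deriv r) (σ s)) s :=
    ((hr.differentiable_deriv_two) (σ s)).hasDerivAt.scomp s hσ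
  refine ((hθ.sub hσ).sub ((hX.sub hr1).inner ℝ hr2)).congr_deriv ?_
  rw [Pi.sub_apply, inner_sub_left d, real_inner_smul_right, real_inner_smul_left]
  ring

end RetardedTime

/-- the field `E = −∇φ − DA` obtained from the Liénard–Wiechert
potentials has the explicit representation
`E = −u·z²·a + u·z³·⟨e,a⟩·e − u·z³·⟨e,a⟩·v + u²·z³·e − u²·z³·⟨v,v⟩·e − u²·z³·v + u²·z³·⟨v,v⟩·v`. -/
theorem electric_field_explicit_formula
    (r2 : ℝ → EuclideanSpace ℝ (Fin 3)) (v1 : ℝ)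
    (hv0 : 0 ≤ v1) (hv1 : v1 < 1)
    (hC2 : ContDiff ℝ 2 r2) (hbd : ∀ s : ℝ, ‖deriv r2 s‖ ≤ v1)
    (τ : EuclideanSpace ℝ (Fin 3) × ℝ → ℝ)
    (hτ : ∀ p : EuclideanSpace ℝ (Fin 3) × ℝ, τ p = p.2 - ‖p.1 - r2 (τ p)‖)
    (T : EuclideanSpace ℝ (Fin 3) × ℝ → ℝ)
    (hT : ∀ p, T p = p.2 - τ p)
    (u : EuclideanSpace ℝ (Fin 3) × ℝ → ℝ)
    (hu : ∀ p, u p = (T p)⁻¹)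
    (e : EuclideanSpace ℝ (Fin 3) × ℝ → EuclideanSpace ℝ (Fin 3))
    (he : ∀ p, e p = (T p)⁻¹ • (p.1 - r2 (τ p)))
    (v : EuclideanSpace ℝ (Fin 3) × ℝ → EuclideanSpace ℝ (Fin 3))
    (hv : ∀ p, v p = deriv r2 (τ p))
    (a : EuclideanSpace ℝ (Fin 3) × ℝ → EuclideanSpace ℝ (Fin 3))
    (ha : ∀ p, a p = deriv (deriv r2) (τ p))
    (z : EuclideanSpace ℝ (Fin 3) × ℝ → ℝ)
    (hz : ∀ p, z p = (1 - ⟪e p, v p⟫)⁻¹)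
    (A : EuclideanSpace ℝ (Fin 3) × ℝ → EuclideanSpace ℝ (Fin 3))
    (hA : ∀ p, A p = (u p * z p) • v p)
    (φ : EuclideanSpace ℝ (Fin 3) × ℝ → ℝ)
    (hφ : ∀ p, φ p = u p * z p)
    (r1 : EuclideanSpace ℝ (Fin 3)) (t : ℝ)
    (hG : 0 < T (r1, t)) :
    ∀ i : Fin 3,
      -(Dx i φ (r1, t)) - Dt (fun p => A p i) (r1, t) =
        ((-(u (r1, t) * z (r1, t) ^ 2)) • a (r1, t)
          + (u (r1, t) * z (r1, t) ^ 3 * ⟪e (r1, t), a (r1, t)⟫) • e (r1, t)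
          - (u (r1, t) * z (r1, t) ^ 3 * ⟪e (r1, t), a (r1, t)⟫) • v (r1, t)
          + (u (r1, t) ^ 2 * z (r1, t) ^ 3) • e (r1, t)
          - (u (r1, t) ^ 2 * z (r1, t) ^ 3 * ⟪v (r1, t), v (r1, t)⟫) • e (r1, t)
          - (u (r1, t) ^ 2 * z (r1, t) ^ 3) • v (r1, t)
          + (u (r1, t) ^ 2 * z (r1, t) ^ 3 * ⟪v (r1, t), v (r1, t)⟫) • v (r1, t)) i := by
  intro i
  set K : EuclideanSpace ℝ (Fin 3) × ℝ → ℝ :=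
    fun p => p.2 - τ p - ⟪p.1 - r2 (τ p), deriv r2 (τ p)⟫ with hKdef
  have hTnorm (p) : T p = ‖p.1 - r2 (τ p)‖ := by linarith [hT p, hτ p]
  have hφK (p) : φ p = (K p)⁻¹ := by
    rw [hφ, hu, hz, he, hv, ← mul_inv, real_inner_smul_left, hKdef]
    simp only
    rw [← hT p]
    rcases eq_or_ne (T p) 0 with h0 | h0
    · have : p.1 - r2 (τ p) = 0 := by rw [← norm_eq_zero, ← hTnorm, h0]
      simp [h0, this]
    · field_simp
  have hAK (p) : A p i = (K p)⁻¹ * deriv r2 (τ p) i := by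
    rw [hA, ← hφ, hφK, hv]
    simp
  have hK0 : K (r1, t) ≠ 0 := by
    have h1 := real_inner_le_norm (r1 - r2 (τ (r1, t))) (deriv r2 (τ (r1, t)))
    have h2 := hTnorm (r1, t)
    have h3 := mul_le_mul_of_nonneg_left (hbd (τ (r1, t))) hG.le
    simp only at h2
    rw [← h2] at h1
    have h4 : T (r1, t) * v1 < T (r1, t) := by nlinarith
    have h5 := hT (r1, t)
    simp only [hKdef]
    simp only at h5
    linarith
  have hr2 : Differentiable ℝ r2 := hC2.differentiable two_ne_zero
  -- the time direction
  have ht1 : HasDerivAt (fun _ : ℝ => r1) 0 t := hasDerivAt_const t r1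
  have ht2 : HasDerivAt (fun s : ℝ => s) 1 t := hasDerivAt_id t
  have htσ := hasDerivAt_retardedTime (σ := fun s => τ (r1, s)) hv1 hr2 hbd
    (fun s => hτ (r1, s)) ht1 ht2 hK0
  have htK := hasDerivAt_retardedDenominator hC2 ht1 ht2 htσ
  have hw : HasDerivAt (deriv r2) (deriv (deriv r2) (τ (r1, t))) (τ (r1, t)) :=
    (hC2.differentiable_deriv_two (τ (r1, t))).hasDerivAt
  have hwi : HasDerivAt (fun s => deriv r2 s i) (deriv (deriv r2) (τ (r1, t)) i) (τ (r1, t)) :=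
    (EuclideanSpace.proj (𝕜 := ℝ) i).hasFDerivAt.comp_hasDerivAt _ hw
  have htw := HasDerivAt.comp (h₂ := fun s => deriv r2 s i) t hwi htσ
  have hDt := (((htK.fun_inv hK0).mul htw).congr_of_eventuallyEq
    (f₁ := fun s => A (r1, s) i) (.of_forall fun s => hAK (r1, s))).deriv
  -- the space direction
  have hx1 : HasDerivAt (fun h : ℝ => r1 + h • EuclideanSpace.single i (1 : ℝ))
      (EuclideanSpace.single i (1 : ℝ)) 0 := by
    simpa using ((hasDerivAt_id (0 : ℝ)).smul_const
      (EuclideanSpace.single i (1 : ℝ))).const_add r1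
  have hx2 : HasDerivAt (fun _ : ℝ => t) 0 0 := hasDerivAt_const 0 t
  have hx0 : r1 + (0 : ℝ) • EuclideanSpace.single i (1 : ℝ) = r1 := by simp
  have hxσ := hasDerivAt_retardedTime
    (σ := fun h : ℝ => τ (r1 + h • EuclideanSpace.single i (1 : ℝ), t)) hv1 hr2 hbd
    (fun h => hτ (r1 + h • EuclideanSpace.single i (1 : ℝ), t)) hx1 hx2
    (by simpa only [hx0] using hK0)
  have hxK := hasDerivAt_retardedDenominator hC2 hx1 hx2 hxσ
  have hDx := ((hxK.fun_inv (by simpa only [hx0] using hK0)).congr_of_eventuallyEq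
    (f₁ := fun h => φ (r1 + h • EuclideanSpace.single i (1 : ℝ), t))
    (.of_forall fun h => hφK _)).deriv
  simp only [Dt, Dx]
  rw [hDt, hDx]
  have hTt : t - τ (r1, t) = T (r1, t) := (hT (r1, t)).symm
  have hKt : K (r1, t) = T (r1, t) - ⟪r1 - r2 (τ (r1, t)), deriv r2 (τ (r1, t))⟫ := by
    rw [← hTt]
  rw [hKt] at hK0
  have hz' : z (r1, t) = T (r1, t) /
      (T (r1, t) - ⟪r1 - r2 (τ (r1, t)), deriv r2 (τ (r1, t))⟫) := by
    rw [hz, he, hv, real_inner_smul_left]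
    have hT0 := hG.ne'
    rw [← inv_div]
    congr 1
    field_simp
  simp only [Function.comp_apply, hx0, hTt, hz', hu, he, hv, ha, real_inner_smul_left, inner_zero_right,
    inner_zero_left, EuclideanSpace.inner_single_left, EuclideanSpace.inner_single_right,
    PiLp.add_apply, PiLp.sub_apply, PiLp.smul_apply, smul_eq_mul, map_one, conj_trivial]
  simp only [← PiLp.sub_apply]
  have hT0 := hG.ne'
  generalize T (r1, t) - ⟪r1 - r2 (τ (r1, t)), deriv r2 (τ (r1, t))⟫ = k at hK0 ⊢
  field_simp
  ring
end

section
/- Let r2 : ℝ → ℝ³ be three times continuously differentiable with ‖r2' s‖ ≤ v1 for all s ∈ ℝ, where 0 ≤ v1 < 1. Define on G the field E = −u·z²·a + u·z³·⟨e,a⟩·e − u·z³·⟨e,a⟩·v + u²·z³·e − u²·z³·⟨v,v⟩·e − u²·z³·v + u²·z³·⟨v,v⟩·v. Then E is divergence-free on G: ∇·E = D₁E₁ + D₂E₂ + D₃E₃ = 0 at every point of G. -/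
open scoped RealInnerProductSpace

/-- A continuous curve `g` inside the zero set of a `C¹` function `F` of two real variables is
differentiable wherever `∂F/∂y ≠ 0`. -/
theorem differentiableAt_of_apply_eq_zero {F : ℝ × ℝ → ℝ} {g : ℝ → ℝ} {x c : ℝ}
    (hF : ContDiff ℝ 1 F) (hg : ContinuousAt g x) (h0 : ∀ y, F (y, g y) = 0)
    (hFy : HasDerivAt (fun y => F (x, y)) c (g x)) (hc : c ≠ 0) : DifferentiableAt ℝ g x := by
  have hs := hF.contDiffAt.hasStrictFDerivAt (x := (x, g x)) one_ne_zero
  have hval : fderiv ℝ F (x, g x) (0, 1) = c :=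
    (hs.hasFDerivAt.comp_hasDerivAt (g x)
      ((hasDerivAt_const (g x) x).prodMk (hasDerivAt_id (g x)))).unique hFy
  have hinv : (fderiv ℝ F (x, g x) ∘L .inr ℝ ℝ ℝ).IsInvertible := by
    refine ⟨ContinuousLinearEquiv.unitsEquivAut ℝ (Units.mk0 c hc), ?_⟩
    ext
    simp [hval]
  have hloc := (continuousAt_id.prodMk hg).eventually
    (hs.eventually_apply_eq_iff_implicitFunctionOfProdDomain hinv)
  refine (hs.hasStrictFDerivAt_implicitFunctionOfProdDomain hinv).hasFDerivAt.differentiableAt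
    |>.congr_of_eventuallyEq ?_
  filter_upwards [hloc] with y hy
  exact (hy.1 ((h0 y).trans (h0 x).symm)).symm

section RetardedTime

variable {V : Type*} [NormedAddCommGroup V] [InnerProductSpace ℝ V]

/-- A solution of the retarded time equation along a spatial line is continuous. -/
theorem continuous_of_retarded {r : ℝ → V} {v1 t : ℝ} {r1 d : V} {g : ℝ → ℝ}
    (hv1 : v1 < 1) (hr : ∀ s s', ‖r s - r s'‖ ≤ v1 * |s - s'|)
    (hg : ∀ h, g h = t - ‖r1 + h • d - r (g h)‖) : Continuous g := by
  have key : ∀ h h', |g h - g h'| ≤ ‖d‖ / (1 - v1) * |h - h'| := by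
    intro h h'
    have h1 : |g h - g h'| ≤ ‖(r1 + h' • d - r (g h')) - (r1 + h • d - r (g h))‖ := by
      have : g h - g h' = ‖r1 + h' • d - r (g h')‖ - ‖r1 + h • d - r (g h)‖ := by
        linarith [hg h, hg h']
      rw [this]
      exact abs_norm_sub_norm_le _ _
    have h2 : (r1 + h' • d - r (g h')) - (r1 + h • d - r (g h))
        = (r (g h) - r (g h')) - (h - h') • d := by
      rw [sub_smul]; abel
    have h3 := norm_sub_le (r (g h) - r (g h')) ((h - h') • d)
    rw [← h2, norm_smul, Real.norm_eq_abs] at h3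
    rw [div_mul_eq_mul_div, le_div_iff₀ (by linarith)]
    nlinarith [hr (g h) (g h')]
  refine (LipschitzWith.of_dist_le_mul (K := (‖d‖ / (1 - v1)).toNNReal) fun h h' => ?_).continuous
  rw [Real.coe_toNNReal _ (div_nonneg (norm_nonneg d) (by linarith))]
  exact key h h'

/-- The derivative of the retarded time along a spatial line, where the retarded distance is
positive. -/
theorem hasDerivAt_of_retarded {r : ℝ → V} {v1 t : ℝ} {r1 d : V} {g : ℝ → ℝ}
    (hv1 : v1 < 1) (hC : ContDiff ℝ 1 r) (hr : ∀ s s', ‖r s - r s'‖ ≤ v1 * |s - s'|)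
    (hg : ∀ h, g h = t - ‖r1 + h • d - r (g h)‖)
    (hK : t - g 0 - ⟪r1 - r (g 0), deriv r (g 0)⟫ ≠ 0) :
    HasDerivAt g (-⟪r1 - r (g 0), d⟫ / (t - g 0 - ⟪r1 - r (g 0), deriv r (g 0)⟫)) 0 := by
  have hsq : ∀ h, ‖r1 + h • d - r (g h)‖ ^ 2 - (t - g h) ^ 2 = 0 := fun h => by
    rw [show t - g h = ‖r1 + h • d - r (g h)‖ by linarith [hg h], sub_self]
  have hr' : HasDerivAt r (deriv r (g 0)) (g 0) :=
    (hC.differentiable one_ne_zero).differentiableAt.hasDerivAt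
  have hdiff : DifferentiableAt ℝ g 0 := by
    refine differentiableAt_of_apply_eq_zero
      (F := fun q => ‖r1 + q.1 • d - r q.2‖ ^ 2 - (t - q.2) ^ 2)
      (c := 2 * (t - g 0 - ⟪r1 - r (g 0), deriv r (g 0)⟫)) ?_
      (continuous_of_retarded hv1 hr hg).continuousAt hsq ?_ (mul_ne_zero two_ne_zero hK)
    · refine ContDiff.sub (ContDiff.norm_sq ℝ ?_) (by fun_prop)
      exact (contDiff_const.add (contDiff_fst.smul contDiff_const)).sub (hC.comp contDiff_snd)
    · have h1 := (hr'.const_sub (r1 + (0 : ℝ) • d)).norm_sq.sub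
        (((hasDerivAt_id (g 0)).const_sub t).pow 2)
      refine h1.congr_deriv ?_
      simp [inner_neg_right]
      ring
  obtain ⟨g', hg'⟩ : ∃ g', HasDerivAt g g' 0 := ⟨_, hdiff.hasDerivAt⟩
  have hX : HasDerivAt (fun h : ℝ => r1 + h • d - r (g h)) (d - g' • deriv r (g 0)) 0 := by
    have h1 := (((hasDerivAt_id (0 : ℝ)).smul_const d).const_add r1).sub
      (hr'.scomp (0 : ℝ) hg')
    refine h1.congr_deriv ?_
    simp
  have hzero := (hX.norm_sq.sub ((hg'.const_sub t).pow 2)).unique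
    ((hasDerivAt_const (0 : ℝ) (0 : ℝ)).congr_of_eventuallyEq (.of_forall hsq))
  convert hg' using 1
  rw [div_eq_iff hK]
  simp [inner_sub_right, inner_smul_right] at hzero
  linarith

end RetardedTime

/-- The algebraic cancellation behind Gauss's law for the field of a moving point charge. -/
theorem sum_divergence_terms_eq_zero (x v a b : EuclideanSpace ℝ (Fin 3)) (R K : ℝ)
    (hK : K ≠ 0) (hR : R ^ 2 = ⟪x, x⟫) (hKR : K = R - ⟪x, v⟫) :
    ∑ i : Fin 3,
      ((((⟪x, b⟫ - 3 * ⟪v, a⟫) * (-x i / K) + a i) * (x i - R * v i)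
          + (1 - ⟪v, v⟫ + ⟪x, a⟫) * (1 - R * a i * (-x i / K))
          - (x i / K * K + R * (-(1 - ⟪v, v⟫ + ⟪x, a⟫) * (-x i / K) - v i)) * a i
          - R * K * (b i * (-x i / K))) / K ^ 3
        - 3 * ((1 - ⟪v, v⟫ + ⟪x, a⟫) * (x i - R * v i) - R * K * a i)
          * (-(1 - ⟪v, v⟫ + ⟪x, a⟫) * (-x i / K) - v i) / K ^ 4) = 0 := by
  obtain ⟨P, hP⟩ : ∃ P, P = 1 - ⟪v, v⟫ + ⟪x, a⟫ := ⟨_, rfl⟩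
  obtain ⟨C, hC⟩ : ∃ C, C = ⟪x, b⟫ - 3 * ⟪v, a⟫ := ⟨_, rfl⟩
  rw [← hP, ← hC]
  simp only [PiLp.inner_apply, Fin.sum_univ_three, RCLike.inner_apply, conj_trivial] at *
  field_simp
  linear_combination (C * K + 3 * P ^ 2) * hR + ((C * K + 3 * P ^ 2) * R + 3 * P * K) * hKR
    - R * K ^ 2 * hC - 3 * P * K * R * hP

/-- Derivative in the `i`-th direction of the `i`-th component of the field of a moving point
charge, with the retarded time along the line given by `g`. -/
theorem hasDerivAt_field_component (r : ℝ → EuclideanSpace ℝ (Fin 3)) (hC3 : ContDiff ℝ 3 r)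
    (r1 : EuclideanSpace ℝ (Fin 3)) (t : ℝ) (g : ℝ → ℝ) (i : Fin 3)
    (x v a b : EuclideanSpace ℝ (Fin 3)) (R K : ℝ)
    (hx : x = r1 - r (g 0)) (hv : v = deriv r (g 0)) (ha : a = deriv (deriv r) (g 0))
    (hb : b = deriv (deriv (deriv r)) (g 0)) (hR : R = t - g 0) (hKR : K = R - ⟪x, v⟫)
    (hK : K ≠ 0) (hg : HasDerivAt g (-x i / K) 0)
    (X : ℝ → EuclideanSpace ℝ (Fin 3))
    (hX : X = fun h => r1 + h • EuclideanSpace.single i (1 : ℝ) - r (g h)) :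
    HasDerivAt (fun h =>
      ((1 - ⟪deriv r (g h), deriv r (g h)⟫ + ⟪X h, deriv (deriv r) (g h)⟫)
          * (X h i - (t - g h) * deriv r (g h) i)
        - (t - g h) * (t - g h - ⟪X h, deriv r (g h)⟫) * deriv (deriv r) (g h) i)
        / (t - g h - ⟪X h, deriv r (g h)⟫) ^ 3)
      ((((⟪x, b⟫ - 3 * ⟪v, a⟫) * (-x i / K) + a i) * (x i - R * v i)
          + (1 - ⟪v, v⟫ + ⟪x, a⟫) * (1 - R * a i * (-x i / K))
          - (x i / K * K + R * (-(1 - ⟪v, v⟫ + ⟪x, a⟫) * (-x i / K) - v i)) * a i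
          - R * K * (b i * (-x i / K))) / K ^ 3
        - 3 * ((1 - ⟪v, v⟫ + ⟪x, a⟫) * (x i - R * v i) - R * K * a i)
          * (-(1 - ⟪v, v⟫ + ⟪x, a⟫) * (-x i / K) - v i) / K ^ 4) 0 := by
  have hC2 : ContDiff ℝ 2 (deriv r) := (contDiff_succ_iff_deriv.1 (hC3.of_le (by norm_num) : ContDiff ℝ (2 + 1) r)).2.2
  have hC1 : ContDiff ℝ 1 (deriv (deriv r)) := 
    (contDiff_succ_iff_deriv.1 (hC2.of_le (by norm_num) : ContDiff ℝ (1 + 1) (deriv r))).2.2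
  obtain ⟨g', hg'⟩ : ∃ g', g' = -x i / K := ⟨_, rfl⟩
  have hxi : x i = -(g' * K) := by rw [hg']; field_simp
  rw [← hg'] at hg
  have dr : HasDerivAt (fun h => r (g h)) (g' • v) 0 := by
    rw [hv]
    exact (hC3.differentiable (by norm_num)).differentiableAt.hasDerivAt.scomp (0 : ℝ) hg
  have dV : HasDerivAt (fun h => deriv r (g h)) (g' • a) 0 := by
    rw [ha]
    exact (hC2.differentiable (by norm_num)).differentiableAt.hasDerivAt.scomp (0 : ℝ) hg
  have dA : HasDerivAt (fun h => deriv (deriv r) (g h)) (g' • b) 0 := by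
    rw [hb]
    exact (hC1.differentiable (by norm_num)).differentiableAt.hasDerivAt.scomp (0 : ℝ) hg
  have dX : HasDerivAt X (EuclideanSpace.single i (1 : ℝ) - g' • v) 0 := by
    rw [hX]
    refine ((((hasDerivAt_id (0 : ℝ)).smul_const
      (EuclideanSpace.single i (1 : ℝ))).const_add r1).sub dr).congr_deriv ?_
    simp
  have hcoord : ∀ {f : ℝ → EuclideanSpace ℝ (Fin 3)} {f' : EuclideanSpace ℝ (Fin 3)},
      HasDerivAt f f' 0 → HasDerivAt (fun h => f h i) (f' i) 0 := fun hf =>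
    (EuclideanSpace.proj (𝕜 := ℝ) i).hasFDerivAt.comp_hasDerivAt (0 : ℝ) hf
  have hX0 : X 0 = x := by simp [hX, hx]
  have dR := hg.const_sub t
  have dK := dR.sub (dX.inner ℝ dV)
  have hK0 : t - g 0 - ⟪X 0, deriv r (g 0)⟫ = K := by rw [hX0, ← hv, ← hR, hKR]
  have hD := (((((dV.inner ℝ dV).const_sub 1).add (dX.inner ℝ dA)).mul
    ((hcoord dX).sub (dR.mul (hcoord dV)))).sub ((dR.mul dK).mul (hcoord dA))).div
    (dK.pow 3) (by simp [hK0, hK])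
  refine hD.congr_deriv ?_
  simp only [Pi.add_apply, Pi.sub_apply, Pi.mul_apply, Pi.pow_apply, hK0]
  simp only [hX0, ← hv, ← ha, ← hR]
  have e1 : ⟪EuclideanSpace.single i (1 : ℝ), v⟫ = v i := by simp [EuclideanSpace.inner_single_left]
  have e2 : ⟪EuclideanSpace.single i (1 : ℝ), a⟫ = a i := by simp [EuclideanSpace.inner_single_left]
  simp only [inner_sub_left, inner_smul_left, inner_smul_right, e1, e2, real_inner_comm v a,
    PiLp.sub_apply, PiLp.smul_apply, smul_eq_mul, conj_trivial]
  simp only [PiLp.single_apply, if_true, ← hg']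
  rw [hxi]
  field_simp
  ring

/-- the electric field `E` of the moving point charge is
divergence free on `G`: `∇·E = 0`. -/
theorem electric_field_divergence_free
    (r2 : ℝ → EuclideanSpace ℝ (Fin 3)) (v1 : ℝ)
    (hv0 : 0 ≤ v1) (hv1 : v1 < 1)
    (hC3 : ContDiff ℝ 3 r2) (hbd : ∀ s : ℝ, ‖deriv r2 s‖ ≤ v1)
    (τ : EuclideanSpace ℝ (Fin 3) × ℝ → ℝ)
    (hτ : ∀ p : EuclideanSpace ℝ (Fin 3) × ℝ, τ p = p.2 - ‖p.1 - r2 (τ p)‖)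
    (T : EuclideanSpace ℝ (Fin 3) × ℝ → ℝ)
    (hT : ∀ p, T p = p.2 - τ p)
    (u : EuclideanSpace ℝ (Fin 3) × ℝ → ℝ)
    (hu : ∀ p, u p = (T p)⁻¹)
    (e : EuclideanSpace ℝ (Fin 3) × ℝ → EuclideanSpace ℝ (Fin 3))
    (he : ∀ p, e p = (T p)⁻¹ • (p.1 - r2 (τ p)))
    (v : EuclideanSpace ℝ (Fin 3) × ℝ → EuclideanSpace ℝ (Fin 3))
    (hv : ∀ p, v p = deriv r2 (τ p))
    (a : EuclideanSpace ℝ (Fin 3) × ℝ → EuclideanSpace ℝ (Fin 3))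
    (ha : ∀ p, a p = deriv (deriv r2) (τ p))
    (z : EuclideanSpace ℝ (Fin 3) × ℝ → ℝ)
    (hz : ∀ p, z p = (1 - ⟪e p, v p⟫)⁻¹)
    (E : EuclideanSpace ℝ (Fin 3) × ℝ → EuclideanSpace ℝ (Fin 3))
    (hE : ∀ p, E p =
      (-(u p * z p ^ 2)) • a p
        + (u p * z p ^ 3 * ⟪e p, a p⟫) • e p
        - (u p * z p ^ 3 * ⟪e p, a p⟫) • v p
        + (u p ^ 2 * z p ^ 3) • e p
        - (u p ^ 2 * z p ^ 3 * ⟪v p, v p⟫) • e p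
        - (u p ^ 2 * z p ^ 3) • v p
        + (u p ^ 2 * z p ^ 3 * ⟪v p, v p⟫) • v p)
    (r1 : EuclideanSpace ℝ (Fin 3)) (t : ℝ)
    (hG : 0 < T (r1, t)) :
    ∑ i : Fin 3, Dx i (fun p => E p i) (r1, t) = 0 := by
  have hlip : ∀ s s', ‖r2 s - r2 s'‖ ≤ v1 * |s - s'| := fun s s' =>
    Convex.norm_image_sub_le_of_norm_deriv_le (s := Set.univ)
      (fun y _ => (hC3.differentiable (by norm_num)).differentiableAt)
      (fun y _ => hbd y) convex_univ (Set.mem_univ s') (Set.mem_univ s)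
  have hC1 : ContDiff ℝ 1 r2 := hC3.of_le (by norm_num)
  have hTn : ∀ p, T p = ‖p.1 - r2 (τ p)‖ := fun p => by linarith [hT p, hτ p]
  -- the field without the singular factors `u`, `z`, `e`
  have hEi : ∀ p i, E p i =
      ((1 - ⟪deriv r2 (τ p), deriv r2 (τ p)⟫ + ⟪p.1 - r2 (τ p), deriv (deriv r2) (τ p)⟫)
          * ((p.1 - r2 (τ p)) i - (p.2 - τ p) * deriv r2 (τ p) i)
        - (p.2 - τ p) * (p.2 - τ p - ⟪p.1 - r2 (τ p), deriv r2 (τ p)⟫)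
          * deriv (deriv r2) (τ p) i)
        / (p.2 - τ p - ⟪p.1 - r2 (τ p), deriv r2 (τ p)⟫) ^ 3 := by
    intro p i
    rw [hE, hz, hu, he, hv, ha, ← hT p]
    have hTp := hTn p
    generalize T p = R at *
    generalize p.1 - r2 (τ p) = x at *
    generalize deriv r2 (τ p) = w at *
    generalize deriv (deriv r2) (τ p) = c at *
    simp only [PiLp.add_apply, PiLp.sub_apply, PiLp.smul_apply, smul_eq_mul, inner_smul_left,
      conj_trivial]
    rcases eq_or_ne R 0 with rfl | hR
    · have hx0 : x = 0 := norm_eq_zero.1 hTp.symm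
      simp [hx0]
    · have hz' : (1 - R⁻¹ * ⟪x, w⟫)⁻¹ = R / (R - ⟪x, w⟫) := by
        rw [show 1 - R⁻¹ * ⟪x, w⟫ = (R - ⟪x, w⟫) / R by field_simp, inv_div]
      rw [hz']
      rcases eq_or_ne (R - ⟪x, w⟫) 0 with hK | hK
      · simp [hK]
      · field_simp
        ring
  obtain ⟨s, hs⟩ : ∃ s, s = τ (r1, t) := ⟨_, rfl⟩
  obtain ⟨x, hx⟩ : ∃ x, x = r1 - r2 s := ⟨_, rfl⟩
  obtain ⟨R, hR⟩ : ∃ R, R = t - s := ⟨_, rfl⟩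
  obtain ⟨K, hKR⟩ : ∃ K, K = R - ⟪x, deriv r2 s⟫ := ⟨_, rfl⟩
  have hRpos : 0 < R := by rw [hR, hs]; exact (hT (r1, t)) ▸ hG
  have hRx : R = ‖x‖ := by rw [hR, hx, hs]; exact (hT (r1, t)) ▸ hTn (r1, t)
  have hK : K ≠ 0 := by
    have h1 : ⟪x, deriv r2 s⟫ ≤ R * v1 := by
      rw [hRx]
      exact (real_inner_le_norm _ _).trans (by gcongr; exact hbd s)
    have h2 : 0 < K := by rw [hKR]; nlinarith
    exact h2.ne'
  rw [← sum_divergence_terms_eq_zero x (deriv r2 s) (deriv (deriv r2) s)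
    (deriv (deriv (deriv r2)) s) R K hK (by rw [hRx, real_inner_self_eq_norm_sq]) hKR]
  refine Finset.sum_congr rfl fun i _ => ?_
  obtain ⟨g, hg⟩ : ∃ g : ℝ → ℝ,
    g = fun h => τ (r1 + h • EuclideanSpace.single i (1 : ℝ), t) := ⟨_, rfl⟩
  have hg0 : g 0 = s := by simp [hg, hs]
  have hgd : HasDerivAt g (-x i / K) 0 := by
    have := hasDerivAt_of_retarded (r := r2) (g := g) (t := t) (r1 := r1)
      (d := EuclideanSpace.single i (1 : ℝ)) hv1 hC1 hlip
      (fun h => by rw [hg]; exact hτ _)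
      (by rw [hg0, ← hx, ← hR, ← hKR]; exact hK)
    rw [hg0, ← hx, ← hR, ← hKR] at this
    simpa [EuclideanSpace.inner_single_right] using this
  have hD := hasDerivAt_field_component r2 hC3 r1 t g i x (deriv r2 s) (deriv (deriv r2) s)
    (deriv (deriv (deriv r2)) s) R K (by rw [hg0, hx]) (by rw [hg0]) (by rw [hg0]) (by rw [hg0])
    (by rw [hg0, hR]) hKR hK hgd _ rfl
  refine Eq.trans ?_ hD.deriv
  simp only [Dx, hEi, hg]
end

section
/- Let r2 : ℝ → ℝ³ be three times continuously differentiable with ‖r2' s‖ ≤ v1 for all s ∈ ℝ, where 0 ≤ v1 < 1. Then the scalar Liénard–Wiechert potential φ = u·z satisfies the homogeneous wave equation on G: □²φ = ∇²φ − D²φ = D₁²φ + D₂²φ + D₃²φ − D²φ = 0 at every point of G. -/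
open scoped RealInnerProductSpace

section RetardedTime

variable {E : Type*} [NormedAddCommGroup E] [InnerProductSpace ℝ E]

/-- A Lipschitz solution `g` of the implicit equation `F (x, g x) = 0` is differentiable. -/
theorem HasFDerivAt.of_implicit_of_isBigO_s19 {V : Type*} [NormedAddCommGroup V] [NormedSpace ℝ V]
    {F : V × ℝ → ℝ} {F' : V × ℝ →L[ℝ] ℝ} {g : V → ℝ} {p : V} {c : ℝ}
    (hF : HasFDerivAt F F' (p, g p)) (hc : F' (0, 1) = c) (hc0 : c ≠ 0)
    (hg : (fun y => g y - g p) =O[nhds p] fun y => y - p) (h0 : ∀ y, F (y, g y) = 0) :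
    HasFDerivAt g (-c⁻¹ • F'.comp (ContinuousLinearMap.inl ℝ V ℝ)) p := by
  have hcont : Filter.Tendsto g (nhds p) (nhds (g p)) := by
    have h1 : Filter.Tendsto (fun y => y - p) (nhds p) (nhds 0) :=
      (continuous_id.sub continuous_const).tendsto' _ _ (sub_self p)
    exact tendsto_sub_nhds_zero_iff.1 (hg.trans_tendsto h1)
  have hpair : Filter.Tendsto (fun y => (y, g y)) (nhds p) (nhds (p, g p)) :=
    Filter.tendsto_id.prodMk_nhds hcont
  have hlo := hF.isLittleO.comp_tendsto hpair
  have hbig : ((fun q : V × ℝ => q - (p, g p)) ∘ fun y => (y, g y)) =O[nhds p]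
      fun y => y - p := (Asymptotics.isBigO_refl _ _).prod_left hg
  have h := (hlo.trans_isBigO hbig).const_mul_left (-c⁻¹)
  refine HasFDerivAt.of_isLittleO (h.congr_left fun y => ?_)
  have hsplit : F' (y - p, g y - g p) = F' (y - p, 0) + (g y - g p) * c := by
    rw [← hc, ← smul_eq_mul, ← map_smul, ← map_add]
    simp
  simp only [Function.comp_apply, h0, Prod.mk_sub_mk, hsplit, sub_self, zero_sub, mul_neg, neg_mul,
    smul_apply, ContinuousLinearMap.comp_apply, ContinuousLinearMap.inl_apply,
    smul_eq_mul]
  field_simp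
  ring

/-- The quantity `(t - s) - ⟪x - q s, deriv q s⟫`, whose inverse at the retarded time is the scalar
Liénard–Wiechert potential. -/
noncomputable def retardedDenom (q : ℝ → E) (x : E) (t s : ℝ) : ℝ :=
  (t - s) - ⟪x - q s, deriv q s⟫

/-- The partial derivative of `retardedDenom` in its last argument. -/
noncomputable def retardedDenomDeriv (q : ℝ → E) (x : E) (s : ℝ) : ℝ :=
  -1 + ⟪deriv q s, deriv q s⟫ - ⟪x - q s, deriv (deriv q) s⟫

/-- The derivative of half the Lorentz square of `(x - q s, t - s)` in the direction `(a, b)`. -/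
noncomputable def retardedNumer (q : ℝ → E) (a : E) (b : ℝ) (x : E) (t s : ℝ) : ℝ :=
  b * (t - s) - ⟪a, x - q s⟫

section Curve

variable {q : ℝ → E} {x a : E} {t b : ℝ} {σ : ℝ → ℝ} {σ' : ℝ}

theorem hasDerivAt_line (x a : E) : HasDerivAt (fun h : ℝ => x + h • a) a 0 := by
  simpa using ((hasDerivAt_id (0 : ℝ)).smul_const a).const_add x

theorem hasDerivAt_retardedDenom (hq : ContDiff ℝ 3 q) (hσ : HasDerivAt σ σ' 0) :
    HasDerivAt (fun h => retardedDenom q (x + h • a) (t + h * b) (σ h))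
      (b - ⟪a, deriv q (σ 0)⟫ + retardedDenomDeriv q x (σ 0) * σ') 0 := by
  have h0 : Differentiable ℝ q := hq.differentiable (by norm_num)
  have h1 : Differentiable ℝ (deriv q) :=
    ((contDiff_succ_iff_deriv (n := 2)).1 (by norm_num; exact hq)).2.2.differentiable (by norm_num)
  have hq0 : HasDerivAt (fun h => q (σ h)) _ 0 := (h0 (σ 0)).hasDerivAt.scomp 0 hσ
  have hq1 : HasDerivAt (fun h => deriv q (σ h)) _ 0 := (h1 (σ 0)).hasDerivAt.scomp 0 hσ
  have hb : HasDerivAt (fun h => t + h * b) b 0 := by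
    simpa using ((hasDerivAt_id (0 : ℝ)).mul_const b).const_add t
  refine ((hb.sub hσ).sub (((hasDerivAt_line x a).sub hq0).inner ℝ hq1)).congr_deriv ?_
  simp [retardedDenomDeriv, inner_sub_left, inner_smul_left, inner_smul_right]
  ring

theorem hasDerivAt_retardedNumer (hq : ContDiff ℝ 3 q) (hσ : HasDerivAt σ σ' 0) :
    HasDerivAt (fun h => retardedNumer q a b (x + h • a) (t + h * b) (σ h))
      (b ^ 2 - ⟪a, a⟫ - (b - ⟪a, deriv q (σ 0)⟫) * σ') 0 := by
  have h0 : Differentiable ℝ q := hq.differentiable (by norm_num)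
  have hq0 : HasDerivAt (fun h => q (σ h)) _ 0 := (h0 (σ 0)).hasDerivAt.scomp 0 hσ
  have hb : HasDerivAt (fun h => t + h * b) b 0 := by
    simpa using ((hasDerivAt_id (0 : ℝ)).mul_const b).const_add t
  refine (((hb.sub hσ).const_mul b).sub
    ((hasDerivAt_const 0 a).inner ℝ ((hasDerivAt_line x a).sub hq0))).congr_deriv ?_
  simp [inner_sub_right, inner_smul_right]
  ring

theorem hasDerivAt_retardedDenomDeriv (hq : ContDiff ℝ 3 q) (hσ : HasDerivAt σ σ' 0) :
    HasDerivAt (fun h => retardedDenomDeriv q (x + h • a) (σ h))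
      ((3 * ⟪deriv q (σ 0), deriv (deriv q) (σ 0)⟫ -
        ⟪x - q (σ 0), deriv (deriv (deriv q)) (σ 0)⟫) * σ' - ⟪a, deriv (deriv q) (σ 0)⟫) 0 := by
  have h0 : Differentiable ℝ q := hq.differentiable (by norm_num)
  have hc1 : ContDiff ℝ 2 (deriv q) :=
    ((contDiff_succ_iff_deriv (n := 2)).1 (by norm_num; exact hq)).2.2
  have h1 : Differentiable ℝ (deriv q) := hc1.differentiable (by norm_num)
  have h2 : Differentiable ℝ (deriv (deriv q)) :=
    ((contDiff_succ_iff_deriv (n := 1)).1 (by norm_num; exact hc1)).2.2.differentiable (by norm_num)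
  have hq0 : HasDerivAt (fun h => q (σ h)) _ 0 := (h0 (σ 0)).hasDerivAt.scomp 0 hσ
  have hq1 : HasDerivAt (fun h => deriv q (σ h)) _ 0 := (h1 (σ 0)).hasDerivAt.scomp 0 hσ
  have hq2 : HasDerivAt (fun h => deriv (deriv q) (σ h)) _ 0 :=
    (h2 (σ 0)).hasDerivAt.scomp 0 hσ
  refine (((hq1.inner ℝ hq1).const_add (-1)).sub
    (((hasDerivAt_line x a).sub hq0).inner ℝ hq2)).congr_deriv ?_
  simp [inner_sub_left, inner_smul_left, inner_smul_right,
    real_inner_comm (deriv q (σ 0)) (deriv (deriv q) (σ 0))]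
  ring

theorem hasDerivAt_inner_deriv (hq : ContDiff ℝ 3 q) (hσ : HasDerivAt σ σ' 0) :
    HasDerivAt (fun h => ⟪a, deriv q (σ h)⟫) (⟪a, deriv (deriv q) (σ 0)⟫ * σ') 0 := by
  have h1 : Differentiable ℝ (deriv q) :=
    ((contDiff_succ_iff_deriv (n := 2)).1 (by norm_num; exact hq)).2.2.differentiable (by norm_num)
  have hq1 : HasDerivAt (fun h => deriv q (σ h)) _ 0 := (h1 (σ 0)).hasDerivAt.scomp 0 hσ
  refine ((hasDerivAt_const 0 a).inner ℝ hq1).congr_deriv ?_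
  simp [inner_smul_right, mul_comm]

end Curve

section Field

variable {q : ℝ → E} {v1 : ℝ} {τ : E × ℝ → ℝ}

theorem norm_sub_le_of_norm_deriv_le (hq : ContDiff ℝ 3 q) (hbd : ∀ s, ‖deriv q s‖ ≤ v1)
    (s s' : ℝ) : ‖q s - q s'‖ ≤ v1 * |s - s'| :=
  convex_univ.norm_image_sub_le_of_norm_deriv_le (fun y _ => hq.differentiable (by norm_num) y)
    (fun y _ => hbd y) (Set.mem_univ s') (Set.mem_univ s)

theorem abs_retardedTime_sub_le_s19 (hv1 : v1 < 1) (hq : ContDiff ℝ 3 q)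
    (hbd : ∀ s, ‖deriv q s‖ ≤ v1) (hτ : ∀ p, τ p = p.2 - ‖p.1 - q (τ p)‖) (p p' : E × ℝ) :
    |τ p - τ p'| ≤ 2 / (1 - v1) * ‖p - p'‖ := by
  have h1 : |‖p.1 - q (τ p)‖ - ‖p'.1 - q (τ p')‖| ≤ ‖p.1 - p'.1‖ + ‖q (τ p) - q (τ p')‖ := by
    refine (abs_norm_sub_norm_le _ _).trans ?_
    rw [sub_sub_sub_comm]
    exact norm_sub_le _ _
  have h2 := norm_sub_le_of_norm_deriv_le hq hbd (τ p) (τ p')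
  have h3 : ‖p.1 - p'.1‖ ≤ ‖p - p'‖ := norm_fst_le (p - p')
  have h4 : |p.2 - p'.2| ≤ ‖p - p'‖ := norm_snd_le (p - p')
  have h5 : |τ p - τ p'| ≤
      |p.2 - p'.2| + |‖p.1 - q (τ p)‖ - ‖p'.1 - q (τ p')‖| := by
    calc |τ p - τ p'|
        = |(p.2 - p'.2) - (‖p.1 - q (τ p)‖ - ‖p'.1 - q (τ p')‖)| := by
          congr 1; linarith [hτ p, hτ p']
      _ ≤ _ := abs_sub _ _
  rw [div_mul_eq_mul_div, le_div_iff₀ (by linarith)]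
  linarith

theorem continuous_retardedTime_s19 (hv1 : v1 < 1) (hq : ContDiff ℝ 3 q)
    (hbd : ∀ s, ‖deriv q s‖ ≤ v1) (hτ : ∀ p, τ p = p.2 - ‖p.1 - q (τ p)‖) : Continuous τ :=
  (LipschitzWith.of_dist_le' fun p p' => by
    rw [Real.dist_eq, dist_eq_norm]
    exact abs_retardedTime_sub_le_s19 hv1 hq hbd hτ p p').continuous

theorem retardedDenom_pos (hv1 : v1 < 1) (hbd : ∀ s, ‖deriv q s‖ ≤ v1)
    (hτ : ∀ p, τ p = p.2 - ‖p.1 - q (τ p)‖) {p : E × ℝ} (hp : τ p < p.2) :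
    0 < retardedDenom q p.1 p.2 (τ p) := by
  have h1 := real_inner_le_norm (p.1 - q (τ p)) (deriv q (τ p))
  have h2 : ‖p.1 - q (τ p)‖ = p.2 - τ p := by linarith [hτ p]
  rw [h2] at h1
  unfold retardedDenom
  nlinarith [hbd (τ p)]

theorem hasDerivAt_retardedTime_s19 (hv1 : v1 < 1) (hq : ContDiff ℝ 3 q)
    (hbd : ∀ s, ‖deriv q s‖ ≤ v1) (hτ : ∀ p, τ p = p.2 - ‖p.1 - q (τ p)‖)
    {p : E × ℝ} (hp : τ p < p.2) (a : E) (b : ℝ) :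
    HasDerivAt (fun h : ℝ => τ (p.1 + h • a, p.2 + h * b))
      (retardedNumer q a b p.1 p.2 (τ p) / retardedDenom q p.1 p.2 (τ p)) 0 := by
  have hN := retardedDenom_pos hv1 hbd hτ hp
  have hq0 := (hq.differentiable (by norm_num) (τ p)).hasDerivAt
  set F : (E × ℝ) × ℝ → ℝ := fun y => ⟪y.1.1 - q y.2, y.1.1 - q y.2⟫ - (y.1.2 - y.2) ^ 2 with hF
  have hx : HasFDerivAt (fun y : (E × ℝ) × ℝ => y.1.1)
      ((ContinuousLinearMap.fst ℝ E ℝ).comp (ContinuousLinearMap.fst ℝ (E × ℝ) ℝ)) (p, τ p) :=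
    hasFDerivAt_fst.comp _ hasFDerivAt_fst
  have ht : HasFDerivAt (fun y : (E × ℝ) × ℝ => y.1.2)
      ((ContinuousLinearMap.snd ℝ E ℝ).comp (ContinuousLinearMap.fst ℝ (E × ℝ) ℝ)) (p, τ p) :=
    hasFDerivAt_snd.comp _ hasFDerivAt_fst
  have hs : HasFDerivAt (fun y : (E × ℝ) × ℝ => y.2)
      (ContinuousLinearMap.snd ℝ (E × ℝ) ℝ) (p, τ p) := hasFDerivAt_snd
  have hr := hx.sub (hq0.hasFDerivAt.comp (p, τ p) hs)
  have hFd := (hr.inner ℝ hr).sub ((ht.sub hs).pow 2)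
  have hg : (fun y => τ y - τ p) =O[nhds p] fun y => y - p :=
    Asymptotics.IsBigO.of_bound _
      (Filter.Eventually.of_forall fun y => abs_retardedTime_sub_le_s19 hv1 hq hbd hτ y p)
  have hτd := HasFDerivAt.of_implicit_of_isBigO_s19 (F := F) (c := 2 * retardedDenom q p.1 p.2 (τ p))
    hFd ?_ (by positivity) hg ?_
  · have hline : HasDerivAt (fun h : ℝ => (p.1 + h • a, p.2 + h * b)) (a, b) 0 := by
      refine (hasDerivAt_line p.1 a).prodMk ?_
      simpa using ((hasDerivAt_id (0 : ℝ)).mul_const b).const_add p.2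
    have hp0 : (p.1 + (0 : ℝ) • a, p.2 + 0 * b) = p := by simp
    refine (hτd.comp_hasDerivAt_of_eq (0 : ℝ) hline hp0.symm).congr_deriv ?_
    simp [retardedNumer, real_inner_comm]
    field_simp
    ring
  · simp [retardedDenom, real_inner_comm]
    ring
  · intro y
    have : ‖y.1 - q (τ y)‖ = y.2 - τ y := by linarith [hτ y]
    simp [hF, this]

/-- The derivative of the inverse of `retardedDenom` at the retarded time in the direction
`(a, b)`. -/
theorem hasDerivAt_inv_retardedDenom (hv1 : v1 < 1) (hq : ContDiff ℝ 3 q)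
    (hbd : ∀ s, ‖deriv q s‖ ≤ v1) (hτ : ∀ p, τ p = p.2 - ‖p.1 - q (τ p)‖)
    {p : E × ℝ} (hp : τ p < p.2) (a : E) (b : ℝ) :
    HasDerivAt
      (fun h : ℝ => (retardedDenom q (p.1 + h • a) (p.2 + h * b)
        (τ (p.1 + h • a, p.2 + h * b)))⁻¹)
      (-(b - ⟪a, deriv q (τ p)⟫ + retardedDenomDeriv q p.1 (τ p) *
        (retardedNumer q a b p.1 p.2 (τ p) / retardedDenom q p.1 p.2 (τ p))) /
          retardedDenom q p.1 p.2 (τ p) ^ 2) 0 := by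
  have hN := retardedDenom_pos hv1 hbd hτ hp
  have h := hasDerivAt_retardedDenom (x := p.1) (a := a) (t := p.2) (b := b) hq
    (hasDerivAt_retardedTime_s19 hv1 hq hbd hτ hp a b)
  refine (h.fun_inv (by simpa using hN.ne')).congr_deriv ?_
  simp

/-- The second derivative of the inverse of `retardedDenom` at the retarded time in the direction
`(a, b)`. -/
theorem deriv_deriv_inv_retardedDenom (hv1 : v1 < 1) (hq : ContDiff ℝ 3 q)
    (hbd : ∀ s, ‖deriv q s‖ ≤ v1) (hτ : ∀ p, τ p = p.2 - ‖p.1 - q (τ p)‖)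
    {f : E × ℝ → ℝ} (hf : ∀ p, f p = (retardedDenom q p.1 p.2 (τ p))⁻¹)
    {p : E × ℝ} (hp : τ p < p.2) (a : E) (b : ℝ) {A B N c r : ℝ}
    (hA : A = retardedNumer q a b p.1 p.2 (τ p)) (hB : B = retardedDenomDeriv q p.1 (τ p))
    (hN : N = retardedDenom q p.1 p.2 (τ p)) (hc : c = b - ⟪a, deriv q (τ p)⟫)
    (hr : r = 3 * ⟪deriv q (τ p), deriv (deriv q) (τ p)⟫ -
      ⟪p.1 - q (τ p), deriv (deriv (deriv q)) (τ p)⟫) :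
    deriv (fun h : ℝ => deriv (fun k : ℝ =>
        f (p.1 + h • a + k • a, p.2 + h * b + k * b)) 0) 0 =
      2 * (c + B * (A / N)) ^ 2 / N ^ 3 -
        (-2 * ⟪a, deriv (deriv q) (τ p)⟫ * (A / N) + r * (A / N) ^ 2 +
          B * (b ^ 2 - ⟪a, a⟫ - c * (A / N)) / N - B * A * (c + B * (A / N)) / N ^ 2) / N ^ 2 := by
  have hN0 : N ≠ 0 := hN ▸ (retardedDenom_pos hv1 hbd hτ hp).ne'
  have hσ := hasDerivAt_retardedTime_s19 hv1 hq hbd hτ hp a b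
  have hev : ∀ᶠ h : ℝ in nhds 0, τ (p.1 + h • a, p.2 + h * b) < p.2 + h * b := by
    have hcont := continuous_retardedTime_s19 hv1 hq hbd hτ
    refine ContinuousAt.eventually_lt (f := fun h : ℝ => τ (p.1 + h • a, p.2 + h * b))
      (g := fun h : ℝ => p.2 + h * b) ?_ ?_ (by simpa using hp)
    · exact (hcont.comp (by fun_prop)).continuousAt
    · fun_prop
  have heq : (fun h : ℝ => deriv (fun k : ℝ =>
      f (p.1 + h • a + k • a, p.2 + h * b + k * b)) 0) =ᶠ[nhds 0] fun h =>
      -(b - ⟪a, deriv q (τ (p.1 + h • a, p.2 + h * b))⟫ +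
        retardedDenomDeriv q (p.1 + h • a) (τ (p.1 + h • a, p.2 + h * b)) *
        (retardedNumer q a b (p.1 + h • a) (p.2 + h * b) (τ (p.1 + h • a, p.2 + h * b)) /
          retardedDenom q (p.1 + h • a) (p.2 + h * b) (τ (p.1 + h • a, p.2 + h * b)))) /
        retardedDenom q (p.1 + h • a) (p.2 + h * b) (τ (p.1 + h • a, p.2 + h * b)) ^ 2 := by
    filter_upwards [hev] with h hh
    simp only [hf]
    exact (hasDerivAt_inv_retardedDenom hv1 hq hbd hτ
      (p := (p.1 + h • a, p.2 + h * b)) hh a b).deriv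
  rw [heq.deriv_eq]
  have dN := hasDerivAt_retardedDenom (x := p.1) (a := a) (t := p.2) (b := b) hq hσ
  have dA := hasDerivAt_retardedNumer (x := p.1) (a := a) (t := p.2) (b := b) hq hσ
  have dB := hasDerivAt_retardedDenomDeriv (x := p.1) (a := a) hq hσ
  have dw := hasDerivAt_inner_deriv (a := a) hq hσ
  have d := ((dw.const_sub b).add (dB.mul (dA.div dN (by simpa [← hN] using hN0)))).neg.div
    (dN.pow 2) (by simpa [← hN] using hN0)
  refine (d.congr_deriv ?_).deriv
  simp [← hA, ← hB, ← hN, ← hc, ← hr]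
  field_simp
  ring

end Field

end RetardedTime

theorem Dx_Dx_eq (i : Fin 3) (f : EuclideanSpace ℝ (Fin 3) × ℝ → ℝ)
    (p : EuclideanSpace ℝ (Fin 3) × ℝ) :
    Dx i (fun y => Dx i f y) p = deriv (fun h : ℝ => deriv (fun k : ℝ =>
      f (p.1 + h • EuclideanSpace.single i (1 : ℝ) + k • EuclideanSpace.single i (1 : ℝ),
        p.2 + h * 0 + k * 0)) 0) 0 := by
  simp [Dx]

theorem Dt_eq (f : EuclideanSpace ℝ (Fin 3) × ℝ → ℝ) (p : EuclideanSpace ℝ (Fin 3) × ℝ) :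
    Dt f p = deriv (fun h : ℝ => f (p.1, p.2 + h)) 0 := by
  rw [deriv_comp_const_add (fun s => f (p.1, s)) p.2 0, add_zero, Dt]

theorem Dt_Dt_eq (f : EuclideanSpace ℝ (Fin 3) × ℝ → ℝ) (p : EuclideanSpace ℝ (Fin 3) × ℝ) :
    Dt (fun y => Dt f y) p = deriv (fun h : ℝ => deriv (fun k : ℝ =>
      f (p.1 + h • (0 : EuclideanSpace ℝ (Fin 3)) + k • (0 : EuclideanSpace ℝ (Fin 3)),
        p.2 + h * 1 + k * 1)) 0) 0 := by
  simp [Dt_eq]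

/-- the scalar Liénard–Wiechert potential `φ = u·z` satisfies the
homogeneous wave equation `□²φ = ∇²φ − D²φ = 0` on `G`. -/
theorem scalar_potential_wave_equation
    (r2 : ℝ → EuclideanSpace ℝ (Fin 3)) (v1 : ℝ)
    (hv0 : 0 ≤ v1) (hv1 : v1 < 1)
    (hC3 : ContDiff ℝ 3 r2) (hbd : ∀ s : ℝ, ‖deriv r2 s‖ ≤ v1)
    (τ : EuclideanSpace ℝ (Fin 3) × ℝ → ℝ)
    (hτ : ∀ p : EuclideanSpace ℝ (Fin 3) × ℝ, τ p = p.2 - ‖p.1 - r2 (τ p)‖)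
    (T : EuclideanSpace ℝ (Fin 3) × ℝ → ℝ)
    (hT : ∀ p, T p = p.2 - τ p)
    (u : EuclideanSpace ℝ (Fin 3) × ℝ → ℝ)
    (hu : ∀ p, u p = (T p)⁻¹)
    (e : EuclideanSpace ℝ (Fin 3) × ℝ → EuclideanSpace ℝ (Fin 3))
    (he : ∀ p, e p = (T p)⁻¹ • (p.1 - r2 (τ p)))
    (v : EuclideanSpace ℝ (Fin 3) × ℝ → EuclideanSpace ℝ (Fin 3))
    (hv : ∀ p, v p = deriv r2 (τ p))
    (z : EuclideanSpace ℝ (Fin 3) × ℝ → ℝ)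
    (hz : ∀ p, z p = (1 - ⟪e p, v p⟫)⁻¹)
    (φ : EuclideanSpace ℝ (Fin 3) × ℝ → ℝ)
    (hφ : ∀ p, φ p = u p * z p)
    (r1 : EuclideanSpace ℝ (Fin 3)) (t : ℝ)
    (hG : 0 < T (r1, t)) :
    (∑ i : Fin 3, Dx i (fun p => Dx i φ p) (r1, t)) -
      Dt (fun p => Dt φ p) (r1, t) = 0 := by
  have hp : τ (r1, t) < t := by
    have := hT (r1, t)
    simp only at this
    linarith
  have hf : ∀ p, φ p = (retardedDenom r2 p.1 p.2 (τ p))⁻¹ := by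
    intro p
    by_cases h0 : T p = 0
    · have h1 : p.1 - r2 (τ p) = 0 := by
        rw [← norm_eq_zero]
        linarith [hτ p, hT p]
      have h2 : p.2 - τ p = 0 := by rw [← hT, h0]
      simp [hφ, hu, h0, retardedDenom, h1, h2]
    · rw [hφ, hu, hz, he, hv, ← mul_inv, inner_smul_left, retardedDenom, ← hT]
      congr 1
      simp
      field_simp
  have hN := retardedDenom_pos hv1 hbd hτ (p := (r1, t)) hp
  have hR : ⟪r1 - r2 (τ (r1, t)), r1 - r2 (τ (r1, t))⟫ = (t - τ (r1, t)) ^ 2 := by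
    have : ‖r1 - r2 (τ (r1, t))‖ = t - τ (r1, t) := by
      have := hτ (r1, t)
      simp only at this
      linarith
    rw [real_inner_self_eq_norm_sq, this]
  rw [Dt_Dt_eq, deriv_deriv_inv_retardedDenom hv1 hC3 hbd hτ hf hp _ _ rfl rfl rfl rfl rfl]
  simp_rw [Dx_Dx_eq, deriv_deriv_inv_retardedDenom hv1 hC3 hbd hτ hf hp _ _ rfl rfl rfl rfl rfl]
  have hNdef : retardedDenom r2 r1 t (τ (r1, t)) =
    t - τ (r1, t) - ⟪r1 - r2 (τ (r1, t)), deriv r2 (τ (r1, t))⟫ := rfl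
  have hBdef : retardedDenomDeriv r2 r1 (τ (r1, t)) =
    -1 + ⟪deriv r2 (τ (r1, t)), deriv r2 (τ (r1, t))⟫ -
      ⟪r1 - r2 (τ (r1, t)), deriv (deriv r2) (τ (r1, t))⟫ := rfl
  simp only [retardedNumer] at hN ⊢
  generalize retardedDenom r2 r1 t (τ (r1, t)) = N at *
  generalize retardedDenomDeriv r2 r1 (τ (r1, t)) = B at *
  generalize 3 * ⟪deriv r2 (τ (r1, t)), deriv (deriv r2) (τ (r1, t))⟫ -
    ⟪r1 - r2 (τ (r1, t)), deriv (deriv (deriv r2)) (τ (r1, t))⟫ = r at *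
  generalize r1 - r2 (τ (r1, t)) = x at *
  generalize deriv (deriv r2) (τ (r1, t)) = y at *
  generalize deriv r2 (τ (r1, t)) = w at *
  generalize t - τ (r1, t) = R at *
  simp only [PiLp.inner_apply, Fin.sum_univ_three, RCLike.inner_apply, conj_trivial] at hNdef hBdef hR
  simp [Fin.sum_univ_three, PiLp.inner_apply]
  field_simp
  linear_combination (3 * B ^ 2 - N * r) * hR - 2 * N ^ 2 * hBdef + 6 * N * B * hNdef
end
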